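/- Fix ε > 0 small, an integer r ≥ 1, and δ > 0. There is a constant C such that the following holds for X large. Let T_0 = X^{0.01}, T ≥ T_0, 1 ≤ P ≤ X^{0.01}, and 0 ≤ α_1, α_2 ≤ 1. Let K(s) = Σ_{n ∼ K} a_n·n^{−s} and M(s) = Σ_{m ∼ M} c_m·m^{−s} with K = X/M ≥ X^ε, where |c_m| ≤ d_r(m) and a_n = 1_S(n) for a set S of integers each of whose elements has at most r prime factors in [P, 2P] and no prime factor in [1, X^{0.01}] \ ∪_{i=1}^r [Z_i, Z_i²] for some Z_1, …, Z_r ≥ 1. Let P(s) = Σ_{p ∼ P} b_p·p^{−s} with |b_p| ≤ 1, and let T' = {t ∈ [T_0, T] : |P(1+it)| ≥ P^{−α_1} and |M(1+it)| ≤ M^{−α_2}}. Then, with ℓ = ⌈log(X/K)/log P⌉, ∫_{T'} |K(1+it)·M(1+it)|² dt ≤ C·M^{−2α_2}·P^{(2+10ε)·α_1·ℓ}·(ℓ!)^{1+δ}·( T/(X·log X) + 1/(log X)² ). -/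

import Mathlib

open scoped Classical

/-- The `r`-fold divisor function `d_r(m)`. -/
noncomputable def drFun (r m : ℕ) : ℕ :=
  Nat.card {f : Fin r → ℕ // ∏ i, f i = m}

/-- `K(1+it) = Σ_{n ∼ K} 1_S(n) n^{-1-it}`. -/
noncomputable def indicatorPoly (K : ℝ) (S : Set ℕ) (t : ℝ) : ℂ :=
  ∑' n : ℕ, if n ∈ S ∧ K ≤ (n : ℝ) ∧ (n : ℝ) < 2 * K then
    (n : ℂ) ^ (-(1 + (t : ℂ) * Complex.I)) else 0

/-- `M(1+it) = Σ_{m ∼ M} c_m m^{-1-it}`. -/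
noncomputable def genPoly (M : ℝ) (c : ℕ → ℂ) (t : ℝ) : ℂ :=
  ∑' m : ℕ, if M ≤ (m : ℝ) ∧ (m : ℝ) < 2 * M then
    c m * (m : ℂ) ^ (-(1 + (t : ℂ) * Complex.I)) else 0

/-- `P(1+it) = Σ_{p ∼ P} b_p p^{-1-it}`. -/
noncomputable def primeCoeffPoly (P : ℝ) (b : ℕ → ℂ) (t : ℝ) : ℂ :=
  ∑' p : ℕ, if p.Prime ∧ P ≤ (p : ℝ) ∧ (p : ℝ) < 2 * P then
    b p * (p : ℂ) ^ (-(1 + (t : ℂ) * Complex.I)) else 0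

section

open Finset

/-- Multiplicativity of complete sums of periodic functions with coprime periods. -/
theorem sum_range_mul_of_periodic {m n : ℕ} (hm : 0 < m) (hn : 0 < n) (hmn : m.Coprime n)
    (f g : ℕ → ℝ) (hf : ∀ k, f (k % m) = f k) (hg : ∀ k, g (k % n) = g k) :
    ∑ k ∈ range (m * n), f k * g k = (∑ a ∈ range m, f a) * ∑ b ∈ range n, g b := by
  rw [sum_mul_sum, ← sum_product']
  refine sum_bij (fun k _ => (k % m, k % n)) ?_ ?_ ?_ ?_
  · intro k _
    simp [Nat.mod_lt _ hm, Nat.mod_lt _ hn]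
  · intro k hk l hl h
    simp only [Prod.mk.injEq] at h
    have : k ≡ l [MOD m * n] := (Nat.modEq_and_modEq_iff_modEq_mul hmn).1 h
    exact Nat.ModEq.eq_of_lt_of_lt this (mem_range.1 hk) (mem_range.1 hl)
  · rintro ⟨a, b⟩ hab
    simp only [mem_product, mem_range] at hab
    refine ⟨Nat.chineseRemainder hmn a b, ?_, ?_⟩
    · exact mem_range.2 (Nat.chineseRemainder_lt_mul hmn a b hm.ne' hn.ne')
    · have h := (Nat.chineseRemainder hmn a b).2
      exact Prod.ext (Eq.trans h.1 (Nat.mod_eq_of_lt hab.1)) (Eq.trans h.2 (Nat.mod_eq_of_lt hab.2))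
  · intro k _
    rw [hf, hg]

theorem prod_periodic_mod {s : Finset ℕ} (f : ℕ → ℕ → ℝ) (hf : ∀ p ∈ s, ∀ k, f p (k % p) = f p k)
    {D : ℕ} (hD : ∀ p ∈ s, p ∣ D) (k : ℕ) : ∏ p ∈ s, f p (k % D) = ∏ p ∈ s, f p k := by
  refine prod_congr rfl fun p hp => ?_
  rw [← hf p hp, Nat.mod_mod_of_dvd _ (hD p hp), hf p hp]

theorem sum_range_prod_of_periodic {s : Finset ℕ} (hs : ∀ p ∈ s, p.Prime) (f : ℕ → ℕ → ℝ)
    (hf : ∀ p ∈ s, ∀ k, f p (k % p) = f p k) :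
    ∑ k ∈ range (∏ p ∈ s, p), ∏ p ∈ s, f p k = ∏ p ∈ s, ∑ a ∈ range p, f p a := by
  induction s using Finset.induction_on with
  | empty => simp
  | insert q s hq ih =>
    simp only [prod_insert hq]
    rw [← ih (fun p hp => hs p (mem_insert_of_mem hp)) fun p hp => hf p (mem_insert_of_mem hp)]
    refine sum_range_mul_of_periodic (hs q (mem_insert_self _ _)).pos
      (prod_pos fun p hp => (hs p (mem_insert_of_mem hp)).pos) ?_ (f q) _
      (hf q (mem_insert_self _ _)) ?_
    · refine Nat.Coprime.prod_right fun p hp => ?_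
      refine (Nat.coprime_primes (hs q (mem_insert_self _ _)) (hs p (mem_insert_of_mem hp))).2 ?_
      rintro rfl
      exact hq hp
    · intro k
      exact prod_periodic_mod f (fun p hp => hf p (mem_insert_of_mem hp))
        (fun p hp => dvd_prod_of_mem _ hp) k

theorem sum_Ico_add_period {D : ℕ} (f : ℕ → ℝ) (hf : ∀ k, f (k % D) = f k) (a : ℕ) :
    ∑ k ∈ Ico a (a + D), f k = ∑ k ∈ range D, f k := by
  induction a with
  | zero => simp
  | succ a ih =>
    rw [← ih]
    rcases Nat.eq_zero_or_pos D with rfl | hD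
    · simp
    have h1 := sum_Ico_succ_top (f := f) (show a ≤ a + D by omega)
    have h2 := sum_eq_sum_Ico_succ_bot (f := f) (show a < a + D + 1 by omega)
    have h3 : f (a + D) = f a := by rw [← hf, Nat.add_mod_right, hf]
    rw [show a + 1 + D = a + D + 1 by ring]
    linarith

/-- A periodic function bounded by one has, over an interval, at most the expected sum up to an
error of one period. -/
theorem sum_Ico_le_of_periodic {D : ℕ} (hD : 0 < D) (f : ℕ → ℝ) (hf : ∀ k, f (k % D) = f k)
    (hf1 : ∀ k, f k ≤ 1) (h0 : 0 ≤ ∑ k ∈ range D, f k) (a N : ℕ) :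
    ∑ k ∈ Ico a (a + N), f k ≤ N / D * (∑ k ∈ range D, f k) + D := by
  have key : ∀ q r : ℕ, ∑ k ∈ Ico a (a + (q * D + r)), f k ≤ q * (∑ k ∈ range D, f k) + r := by
    intro q r
    induction q with
    | zero =>
      simp only [Nat.cast_zero, zero_mul, zero_add]
      refine (sum_le_card_nsmul _ _ 1 fun k _ => hf1 k).trans ?_
      simp
    | succ q ih =>
      rw [← sum_Ico_consecutive f (show a ≤ a + (q * D + r) by omega)
        (show a + (q * D + r) ≤ a + ((q + 1) * D + r) by nlinarith),
        show a + ((q + 1) * D + r) = a + (q * D + r) + D by ring, sum_Ico_add_period f hf]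
      push_cast
      linarith
  have h := key (N / D) (N % D)
  rw [Nat.div_add_mod'] at h
  refine h.trans (add_le_add (mul_le_mul_of_nonneg_right Nat.cast_div_le h0) ?_)
  exact_mod_cast (Nat.mod_lt _ hD).le

/-- The subsets of a set of primes whose product is at most `z`. -/
noncomputable def sieveLevel (B : Finset ℕ) (z : ℝ) : Finset (Finset ℕ) :=
  B.powerset.filter fun s => ((∏ p ∈ s, p : ℕ) : ℝ) ≤ z

/-- The Selberg sieve denominator when `w` classes are removed modulo each prime. -/
noncomputable def sieveDenom (w : ℕ) (B : Finset ℕ) (z : ℝ) : ℝ :=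
  ∑ s ∈ sieveLevel B z, ∏ p ∈ s, ((w : ℝ) / (p - w))

theorem card_sieveLevel_le {B : Finset ℕ} (hB : ∀ p ∈ B, p.Prime) {z : ℝ} (hz : 0 ≤ z) :
    ((sieveLevel B z).card : ℝ) ≤ z := by
  have h : (sieveLevel B z).card ≤ (Icc 1 ⌊z⌋₊).card := by
    refine card_le_card_of_injOn (fun s => ∏ p ∈ s, p) ?_ ?_
    · intro s hs
      simp only [sieveLevel, coe_filter, mem_powerset, Set.mem_ofPred_eq] at hs
      simp only [coe_Icc, Set.mem_Icc]
      exact ⟨Nat.one_le_iff_ne_zero.2 (prod_pos fun p hp => (hB p (hs.1 hp)).pos).ne',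
        Nat.le_floor hs.2⟩
    · intro s hs t ht hst
      simp only [sieveLevel, coe_filter, mem_powerset, Set.mem_ofPred_eq] at hs ht
      have := congrArg Nat.primeFactors hst
      simpa [Nat.primeFactors_prod (fun p hp => hB p (hs.1 hp)),
        Nat.primeFactors_prod (fun p hp => hB p (ht.1 hp))] using this
  rw [Nat.card_Icc, Nat.add_sub_cancel] at h
  exact (Nat.cast_le.2 h).trans (Nat.floor_le hz)

/-- Selberg's upper bound sieve for an interval, with `w` residue classes removed modulo each
prime of `B`. -/
theorem selberg_sieve_le {B : Finset ℕ} (hB : ∀ p ∈ B, p.Prime) {w : ℕ}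
    (hw : ∀ p ∈ B, 2 * w ≤ p) (R : ℕ → ℕ → Prop) (hR : ∀ p ∈ B, ∀ k, R p (k % p) ↔ R p k)
    (hc : ∀ p ∈ B, ((range p).filter (R p)).card = w) {z : ℝ} (hz : 0 ≤ z) (a N : ℕ) :
    (((Ico a (a + N)).filter fun k => ∀ p ∈ B, ¬ R p k).card : ℝ) * sieveDenom w B z ^ 2 ≤
      N * sieveDenom w B z + z ^ 4 := by
  set g : ℕ → ℝ := fun p => (w : ℝ) / (p - w) with hg
  set φ : ℕ → ℕ → ℝ := fun p k => if R p k then -1 else g p with hφ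
  have hpw : ∀ p ∈ B, (0 : ℝ) < p - w := by
    intro p hp
    have h1 : (2 * w : ℝ) ≤ p := by exact_mod_cast hw p hp
    have h2 : (0 : ℝ) < p := by exact_mod_cast (hB p hp).pos
    linarith
  have hg0 : ∀ p ∈ B, 0 ≤ g p := fun p hp => div_nonneg (Nat.cast_nonneg _) (hpw p hp).le
  have hg1 : ∀ p ∈ B, g p ≤ 1 := by
    intro p hp
    have h1 : (2 * w : ℝ) ≤ p := by exact_mod_cast hw p hp
    exact (div_le_one (hpw p hp)).2 (by linarith)
  have hφ1 : ∀ p ∈ B, ∀ k, |φ p k| ≤ 1 := by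
    intro p hp k
    simp only [hφ]
    split_ifs
    · simp
    · rw [abs_of_nonneg (hg0 p hp)]
      exact hg1 p hp
  have hφp : ∀ p ∈ B, ∀ k, φ p (k % p) = φ p k := by
    intro p hp k
    simp only [hφ, hR p hp]
  have hcount : ∀ p ∈ B, ∀ x y : ℝ, ∑ k ∈ range p, (if R p k then x else y) =
      w * x + (p - w) * y := by
    intro p hp x y
    rw [sum_ite, sum_const, sum_const, hc p hp, nsmul_eq_mul, nsmul_eq_mul]
    have h := card_filter_add_card_filter_not (s := range p) (R p)
    rw [hc p hp, card_range] at h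
    have h' : (w : ℝ) + (((range p).filter fun k => ¬ R p k).card : ℝ) = p := by exact_mod_cast h
    rw [← h']
    ring
  have hs1 : ∀ p ∈ B, ∑ k ∈ range p, φ p k = 0 := by
    intro p hp
    rw [hcount p hp]
    have := (hpw p hp).ne'
    simp only [hg]
    field_simp
    ring
  have hs2 : ∀ p ∈ B, ∑ k ∈ range p, φ p k ^ 2 = p * g p := by
    intro p hp
    simp only [hφ, ite_pow]
    rw [hcount p hp]
    have := (hpw p hp).ne'
    simp only [hg]
    field_simp
    ring
  have hmem : ∀ s ∈ sieveLevel B z, s ⊆ B ∧ ((∏ p ∈ s, p : ℕ) : ℝ) ≤ z := by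
    intro s hs
    simpa [sieveLevel] using hs
  have hpair : ∀ s ∈ sieveLevel B z, ∀ t ∈ sieveLevel B z,
      ∑ k ∈ Ico a (a + N), (∏ p ∈ s, φ p k) * (∏ p ∈ t, φ p k) ≤
        (if s = t then N * ∏ p ∈ s, g p else 0) + z ^ 2 := by
    intro s hs t ht
    obtain ⟨hsB, hsz⟩ := hmem s hs
    obtain ⟨htB, htz⟩ := hmem t ht
    have huB : s ∪ t ⊆ B := union_subset hsB htB
    set F : ℕ → ℕ → ℝ := fun p k =>
      (if p ∈ s then φ p k else 1) * (if p ∈ t then φ p k else 1) with hF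
    have hprod : ∀ k, (∏ p ∈ s, φ p k) * (∏ p ∈ t, φ p k) = ∏ p ∈ s ∪ t, F p k := by
      intro k
      rw [prod_mul_distrib, prod_ite_mem, prod_ite_mem, union_inter_cancel_left,
        union_inter_cancel_right]
    have hFp : ∀ p ∈ s ∪ t, ∀ k, F p (k % p) = F p k := by
      intro p hp k
      simp only [hF, hφp p (huB hp)]
    have hF1 : ∀ p ∈ s ∪ t, ∀ k, |F p k| ≤ 1 := by
      intro p hp k
      simp only [hF, abs_mul]
      refine mul_le_one₀ ?_ (abs_nonneg _) ?_ <;> split_ifs <;>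
        first | exact hφ1 p (huB hp) k | simp
    have hDpos : 0 < ∏ p ∈ s ∪ t, p := prod_pos fun p hp => (hB p (huB hp)).pos
    have hDz : ((∏ p ∈ s ∪ t, p : ℕ) : ℝ) ≤ z ^ 2 := by
      have h1 : ∏ p ∈ s ∪ t, p ≤ (∏ p ∈ s, p) * ∏ p ∈ t, p := by
        rw [← prod_union_inter]
        exact Nat.le_mul_of_pos_right _
          (prod_pos fun p hp => (hB p (hsB (mem_inter.1 hp).1)).pos)
      calc ((∏ p ∈ s ∪ t, p : ℕ) : ℝ) ≤ ((∏ p ∈ s, p : ℕ) : ℝ) * ((∏ p ∈ t, p : ℕ) : ℝ) := by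
            exact_mod_cast h1
        _ ≤ z * z := mul_le_mul hsz htz (Nat.cast_nonneg _) hz
        _ = z ^ 2 := (sq z).symm
    have hcomplete : ∑ k ∈ range (∏ p ∈ s ∪ t, p), ∏ p ∈ s ∪ t, F p k =
        if s = t then ((∏ p ∈ s ∪ t, p : ℕ) : ℝ) * ∏ p ∈ s, g p else 0 := by
      rw [sum_range_prod_of_periodic (fun p hp => hB p (huB hp)) F hFp]
      split_ifs with hst
      · subst hst
        rw [union_self, Nat.cast_prod, ← prod_mul_distrib]
        refine prod_congr rfl fun p hp => ?_
        rw [← hs2 p (hsB hp)]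
        refine sum_congr rfl fun k _ => ?_
        simp [hF, hp, sq]
      · have : ∃ p, ¬ (p ∈ s ↔ p ∈ t) := by
          by_contra! h
          exact hst (Finset.ext h)
        obtain ⟨p, hp⟩ := this
        have hpu : p ∈ s ∪ t := by
          rw [mem_union]
          tauto
        refine prod_eq_zero hpu ?_
        rw [← hs1 p (huB hpu)]
        refine sum_congr rfl fun k _ => ?_
        simp only [hF]
        by_cases h1 : p ∈ s
        · rw [if_pos h1, if_neg fun h2 => hp (iff_of_true h1 h2), mul_one]
        · rw [if_neg h1, if_pos ((mem_union.1 hpu).resolve_left h1), one_mul]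
    simp only [hprod]
    have hgs : 0 ≤ ∏ p ∈ s, g p := prod_nonneg fun p hp => hg0 p (hsB hp)
    refine (sum_Ico_le_of_periodic hDpos _ (prod_periodic_mod F hFp
        fun p hp => dvd_prod_of_mem _ hp)
      ?_ ?_ a N).trans (add_le_add ?_ hDz)
    · intro k
      refine (le_abs_self _).trans ?_
      rw [abs_prod]
      exact prod_le_one (fun p _ => abs_nonneg _) fun p hp => hF1 p hp k
    · rw [hcomplete]
      split_ifs
      · positivity
      · exact le_rfl
    · rw [hcomplete]
      have : ((∏ p ∈ s ∪ t, p : ℕ) : ℝ) ≠ 0 := by exact_mod_cast hDpos.ne'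
      split_ifs
      · apply le_of_eq
        field_simp
      · simp
  have hupper : ∑ k ∈ Ico a (a + N), (∑ s ∈ sieveLevel B z, ∏ p ∈ s, φ p k) ^ 2 ≤
      N * sieveDenom w B z + z ^ 4 := by
    calc ∑ k ∈ Ico a (a + N), (∑ s ∈ sieveLevel B z, ∏ p ∈ s, φ p k) ^ 2
        = ∑ s ∈ sieveLevel B z, ∑ t ∈ sieveLevel B z,
            ∑ k ∈ Ico a (a + N), (∏ p ∈ s, φ p k) * (∏ p ∈ t, φ p k) := by
          simp only [sq, sum_mul_sum]
          rw [sum_comm]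
          exact sum_congr rfl fun s _ => sum_comm
      _ ≤ ∑ s ∈ sieveLevel B z, ∑ t ∈ sieveLevel B z,
            ((if s = t then N * ∏ p ∈ s, g p else 0) + z ^ 2) :=
          sum_le_sum fun s hs => sum_le_sum fun t ht => hpair s hs t ht
      _ = N * sieveDenom w B z + ((sieveLevel B z).card : ℝ) ^ 2 * z ^ 2 := by
          simp only [sum_add_distrib, sum_const, nsmul_eq_mul]
          rw [sieveDenom, mul_sum]
          congr 1
          · refine sum_congr rfl fun s hs => ?_
            rw [sum_ite_eq, if_pos hs]
          · ring
      _ ≤ N * sieveDenom w B z + z ^ 2 * z ^ 2 := by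
          have := card_sieveLevel_le hB hz
          gcongr
      _ = N * sieveDenom w B z + z ^ 4 := by ring
  refine le_trans ?_ hupper
  rw [← nsmul_eq_mul, ← sum_const]
  refine (sum_le_sum fun k hk => ?_).trans
    (sum_le_sum_of_subset_of_nonneg (filter_subset _ _) fun k _ _ => sq_nonneg _)
  have hk2 := (mem_filter.1 hk).2
  apply le_of_eq
  congr 1
  refine sum_congr rfl fun s hs => prod_congr rfl fun p hp => ?_
  simp only [hφ, hg, if_neg (hk2 p ((hmem s hs).1 hp))]

theorem one_le_sieveDenom {B : Finset ℕ} {w : ℕ} (hB : ∀ p ∈ B, 2 * w ≤ p) {z : ℝ} (hz : 1 ≤ z) :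
    1 ≤ sieveDenom w B z := by
  have h : ∅ ∈ sieveLevel B z := by simp [sieveLevel, hz]
  have := single_le_sum (f := fun s : Finset ℕ => ∏ p ∈ s, ((w : ℝ) / (p - w)))
      (s := sieveLevel B z)
    (fun s hs => ?_) h
  · simpa [sieveDenom] using this
  · refine prod_nonneg fun p hp => div_nonneg (Nat.cast_nonneg _) ?_
    have h1 : (2 * w : ℝ) ≤ p := by
      exact_mod_cast hB p ((mem_powerset.1 (mem_filter.1 hs).1) hp)
    have : (0 : ℝ) ≤ w := Nat.cast_nonneg _
    linarith

/-- Markov's inequality shows that the truncated sieve sum captures half of the Euler product. -/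
theorem prod_le_two_mul_sieveDenom {B : Finset ℕ} (hP : ∀ p ∈ B, p.Prime) {w : ℕ}
    (hB : ∀ p ∈ B, 2 * w ≤ p) {z : ℝ} (hz : 1 < z)
    (h : ∑ p ∈ B, (w : ℝ) / p * Real.log p ≤ Real.log z / 2) :
    ∏ p ∈ B, ((p : ℝ) / (p - w)) ≤ 2 * sieveDenom w B z := by
  set g : ℕ → ℝ := fun p => (w : ℝ) / (p - w) with hg
  have hpw : ∀ p ∈ B, (0 : ℝ) < p - w ∧ (0 : ℝ) < p := by
    intro p hp
    have h1 : (2 * w : ℝ) ≤ p := by exact_mod_cast hB p hp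
    have h2 : (0 : ℝ) < p := by exact_mod_cast (hP p hp).pos
    exact ⟨by linarith, h2⟩
  have hg0 : ∀ p ∈ B, 0 ≤ g p := fun p hp => div_nonneg (Nat.cast_nonneg _) (hpw p hp).1.le
  have hg1 : ∀ p ∈ B, 1 + g p = (p : ℝ) / (p - w) := by
    intro p hp
    have := (hpw p hp).1.ne'
    simp only [hg]
    field_simp
    ring
  have hfull : ∏ p ∈ B, ((p : ℝ) / (p - w)) = ∑ s ∈ B.powerset, ∏ p ∈ s, g p := by
    rw [← prod_one_add]
    exact (prod_congr rfl hg1).symm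
  have hmean : ∀ A ⊆ B, ∑ s ∈ A.powerset, (∏ p ∈ s, g p) * ∑ p ∈ s, Real.log p =
      (∑ s ∈ A.powerset, ∏ p ∈ s, g p) * ∑ p ∈ A, (w : ℝ) / p * Real.log p := by
    intro A
    induction A using Finset.induction_on with
    | empty => simp
    | insert q A hq ih =>
      intro hA
      have hqB := hA (mem_insert_self q A)
      have e1 : ∀ s ∈ A.powerset, q ∉ s := fun s hs hqs => hq (mem_powerset.1 hs hqs)
      rw [sum_powerset_insert hq, sum_powerset_insert hq, sum_insert hq,
        ih ((subset_insert q A).trans hA)]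
      have e2 : ∑ s ∈ A.powerset, (∏ p ∈ insert q s, g p) * ∑ p ∈ insert q s, Real.log p =
          g q * Real.log q * (∑ s ∈ A.powerset, ∏ p ∈ s, g p) +
            g q * ∑ s ∈ A.powerset, (∏ p ∈ s, g p) * ∑ p ∈ s, Real.log p := by
        rw [mul_sum, mul_sum, ← sum_add_distrib]
        refine sum_congr rfl fun s hs => ?_
        rw [prod_insert (e1 s hs), sum_insert (e1 s hs)]
        ring
      have e3 : ∑ s ∈ A.powerset, ∏ p ∈ insert q s, g p =
          g q * ∑ s ∈ A.powerset, ∏ p ∈ s, g p := by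
        rw [mul_sum]
        exact sum_congr rfl fun s hs => prod_insert (e1 s hs)
      rw [e2, e3, ih ((subset_insert q A).trans hA)]
      have e4 : g q = (1 + g q) * ((w : ℝ) / q) := by
        rw [hg1 q hqB]
        have h1 := (hpw q hqB).1.ne'
        have h2 := (hpw q hqB).2.ne'
        simp only [hg]
        field_simp
      linear_combination (Real.log q * ∑ s ∈ A.powerset, ∏ p ∈ s, g p) * e4
  have hlogz : 0 < Real.log z := Real.log_pos hz
  have htail : ∑ s ∈ B.powerset.filter (fun s => ¬ ((∏ p ∈ s, p : ℕ) : ℝ) ≤ z), ∏ p ∈ s, g p ≤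
      (∑ s ∈ B.powerset, ∏ p ∈ s, g p) / 2 := by
    have hnn : 0 ≤ ∑ s ∈ B.powerset, ∏ p ∈ s, g p :=
      sum_nonneg fun s hs => prod_nonneg fun p hp => hg0 p (mem_powerset.1 hs hp)
    have h1 : (∑ s ∈ B.powerset.filter (fun s => ¬ ((∏ p ∈ s, p : ℕ) : ℝ) ≤ z), ∏ p ∈ s, g p) *
        Real.log z ≤ ∑ s ∈ B.powerset, (∏ p ∈ s, g p) * ∑ p ∈ s, Real.log p := by
      rw [sum_mul]
      refine (sum_le_sum fun s hs => ?_).trans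
        (sum_le_sum_of_subset_of_nonneg (filter_subset _ _) fun s hs _ => ?_)
      · obtain ⟨hs1, hs2⟩ := mem_filter.1 hs
        refine mul_le_mul_of_nonneg_left ?_
          (prod_nonneg fun p hp => hg0 p (mem_powerset.1 hs1 hp))
        rw [← Real.log_prod fun p hp => (hpw p (mem_powerset.1 hs1 hp)).2.ne']
        refine Real.log_le_log (by linarith) ?_
        push_cast at hs2
        linarith
      · refine mul_nonneg (prod_nonneg fun p hp => hg0 p (mem_powerset.1 hs hp))
          (sum_nonneg fun p _ => Real.log_natCast_nonneg p)
    rw [hmean B subset_rfl] at h1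
    have h2 := h1.trans (mul_le_mul_of_nonneg_left h hnn)
    exact le_of_mul_le_mul_right (by linarith) hlogz
  have hsplit := sum_filter_add_sum_filter_not B.powerset
    (fun s => ((∏ p ∈ s, p : ℕ) : ℝ) ≤ z) fun s => ∏ p ∈ s, g p
  rw [hfull]
  have : sieveDenom w B z =
    ∑ s ∈ B.powerset.filter (fun s => ((∏ p ∈ s, p : ℕ) : ℝ) ≤ z), ∏ p ∈ s, g p := rfl
  linarith

/-- An upper Mertens-type bound for the sum of `log p / p`. -/
theorem sum_log_div_le (n : ℕ) :
    ∑ p ∈ (Icc 1 n).filter Nat.Prime, Real.log p / p ≤ 2 * Real.log n := by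
  rcases Nat.eq_zero_or_pos n with rfl | hn
  · simp
  have hn' : (0 : ℝ) < n := by exact_mod_cast hn
  have hdvd : ∏ p ∈ (Icc 1 n).filter Nat.Prime, p ^ (n / p) ∣ n.factorial := by
    refine prod_dvd_of_isRelPrime ?_ ?_
    · intro p hp q hq hpq
      have hp' := (mem_filter.1 hp).2
      have hq' := (mem_filter.1 hq).2
      exact Nat.coprime_iff_isRelPrime.1 (((Nat.coprime_primes hp' hq').2 hpq).pow _ _)
    · intro p hp
      have hp' := (mem_filter.1 hp).2
      rw [hp'.pow_dvd_factorial_iff (Nat.lt_succ_self (Nat.log p n))]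
      rcases Nat.eq_zero_or_pos (Nat.log p n) with h0 | h0
      · have : n / p = 0 := by
          rw [Nat.log_eq_zero_iff] at h0
          rcases h0 with h0 | h0
          · exact Nat.div_eq_of_lt h0
          · exact absurd hp'.one_lt (by omega)
        simp [this]
      · have := single_le_sum (f := fun i => n / p ^ i) (s := Ico 1 (Nat.log p n).succ)
          (fun i _ => Nat.zero_le _) (mem_Ico.2 ⟨le_rfl, by omega⟩)
        simpa using this
  have h1 : ∏ p ∈ (Icc 1 n).filter Nat.Prime, p ^ (n / p) ≤ n ^ n :=
    (Nat.le_of_dvd (Nat.factorial_pos n) hdvd).trans (Nat.factorial_le_pow n)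
  have h2 : ∑ p ∈ (Icc 1 n).filter Nat.Prime, ((n / p : ℕ) : ℝ) * Real.log p ≤
      n * Real.log n := by
    have h3 : ((∏ p ∈ (Icc 1 n).filter Nat.Prime, p ^ (n / p) : ℕ) : ℝ) ≤ (n : ℝ) ^ n := by
      exact_mod_cast h1
    have hpos : ∀ p ∈ (Icc 1 n).filter Nat.Prime, (p : ℝ) ^ (n / p) ≠ 0 := fun p hp =>
      pow_ne_zero _ (by exact_mod_cast (mem_filter.1 hp).2.ne_zero)
    have h4 := Real.log_le_log (by
      exact_mod_cast prod_pos fun p hp => pow_pos (Nat.Prime.pos (mem_filter.1 hp).2) _) h3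
    push_cast at h4
    rw [Real.log_prod hpos, Real.log_pow] at h4
    simpa only [Real.log_pow] using h4
  have h5 : n / 2 * ∑ p ∈ (Icc 1 n).filter Nat.Prime, Real.log p / p ≤ n * Real.log n := by
    refine le_trans ?_ h2
    rw [mul_sum]
    refine sum_le_sum fun p hp => ?_
    obtain ⟨hp1, hp2⟩ := mem_filter.1 hp
    have hp0 : (0 : ℝ) < p := by exact_mod_cast hp2.pos
    have h6 : (n : ℝ) / 2 / p ≤ ((n / p : ℕ) : ℝ) := by
      have h7 : 1 ≤ n / p := (Nat.one_le_div_iff hp2.pos).2 (mem_Icc.1 hp1).2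
      have h8 : n < p * (n / p + 1) := by
        rw [mul_comm]
        exact Nat.lt_mul_of_div_lt (Nat.lt_succ_self _) hp2.pos
      have h9 : (n : ℝ) < p * ((n / p : ℕ) + 1) := by exact_mod_cast h8
      have h10 : (1 : ℝ) ≤ (n / p : ℕ) := by exact_mod_cast h7
      rw [div_le_iff₀ hp0]
      nlinarith
    calc (n : ℝ) / 2 * (Real.log p / p) = (n : ℝ) / 2 / p * Real.log p := by ring
      _ ≤ _ := mul_le_mul_of_nonneg_right h6 (Real.log_natCast_nonneg p)
  refine le_of_mul_le_mul_left (a := (n : ℝ) / 2) ?_ (by positivity)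
  linarith

/-- A lower Mertens-type bound for the Euler product. -/
theorem log_le_prod_primes (n : ℕ) :
    Real.log n ≤ ∏ p ∈ (Icc 1 n).filter Nat.Prime, ((p : ℝ) / (p - 1)) := by
  let f : ℕ →* ℝ := (invMonoidHom : ℝ →* ℝ).comp (Nat.castRingHom ℝ : ℕ →* ℝ)
  have hf : ∀ k : ℕ, f k = (k : ℝ)⁻¹ := fun k => by simp [f]
  have hlt : ∀ {p : ℕ}, p.Prime → ‖f p‖ < 1 := by
    intro p hp
    rw [hf, Real.norm_of_nonneg (by positivity)]
    exact inv_lt_one_of_one_lt₀ (by exact_mod_cast hp.one_lt)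
  obtain ⟨-, h2⟩ := EulerProduct.summable_and_hasSum_factoredNumbers_prod_filter_prime_geometric
    (f := f) hlt (Icc 1 n)
  have hprod : ∏ p ∈ (Icc 1 n).filter Nat.Prime, (1 - f p)⁻¹ =
      ∏ p ∈ (Icc 1 n).filter Nat.Prime, ((p : ℝ) / (p - 1)) := by
    refine prod_congr rfl fun p hp => ?_
    have hp1 : (1 : ℝ) < p := by exact_mod_cast (mem_filter.1 hp).2.one_lt
    have : (p : ℝ) - 1 ≠ 0 := by linarith
    have : (p : ℝ) ≠ 0 := by linarith
    rw [hf]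
    field_simp
  rw [hprod] at h2
  have hmem : ∀ k ∈ Icc 1 n, k ∈ Nat.factoredNumbers (Icc 1 n) := by
    intro k hk
    have hk' := mem_Icc.1 hk
    rw [Nat.mem_factoredNumbers']
    intro p hp hpk
    exact mem_Icc.2 ⟨hp.one_le, (Nat.le_of_dvd (by omega) hpk).trans hk'.2⟩
  have h3 : ∑ k ∈ Icc 1 n, (k : ℝ)⁻¹ ≤ ∏ p ∈ (Icc 1 n).filter Nat.Prime, ((p : ℝ) / (p - 1)) := by
    let e : {k // k ∈ Icc 1 n} ↪ Nat.factoredNumbers (Icc 1 n) :=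
      ⟨fun k => ⟨k.1, hmem k.1 k.2⟩, fun a b h => Subtype.ext (by
        simpa using congrArg (fun x : Nat.factoredNumbers (Icc 1 n) => (x : ℕ)) h)⟩
    have he : ∀ k, ((e k : Nat.factoredNumbers (Icc 1 n)) : ℕ) = k := fun _ => rfl
    have := sum_le_hasSum ((Icc 1 n).attach.map e) (fun m _ => by rw [hf]; positivity) h2
    rw [sum_map] at this
    simp only [hf, he] at this
    rwa [sum_attach (Icc 1 n) fun k => (k : ℝ)⁻¹] at this
  refine le_trans ?_ h3
  rcases Nat.eq_zero_or_pos n with rfl | hn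
  · simp
  have h4 := log_add_one_le_harmonic n
  rw [harmonic_eq_sum_Icc] at h4
  push_cast at h4
  refine le_trans (Real.log_le_log (by exact_mod_cast hn) ?_) h4
  linarith

theorem one_le_div_sub_one {p : ℕ} (hp : 5 ≤ p) : (1 : ℝ) ≤ (p : ℝ) / (p - 1) := by
  have : (5 : ℝ) ≤ p := by exact_mod_cast hp
  rw [le_div_iff₀] <;> linarith

/-- The Euler product over the primes of an interval `[Z, Z ^ 2]` is bounded. -/
theorem prod_primes_interval_le {Z : ℝ} (hZ : 1 ≤ Z) (A : Finset ℕ)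
    (hA : ∀ p ∈ A, p.Prime ∧ 5 ≤ p ∧ Z ≤ p ∧ (p : ℝ) ≤ Z ^ 2) :
    ∏ p ∈ A, ((p : ℝ) / (p - 1)) ≤ Real.exp 8 := by
  rcases A.eq_empty_or_nonempty with rfl | ⟨q, hq⟩
  · simp
  have hZ1 : 1 < Z := by
    obtain ⟨-, h5, -, h⟩ := hA q hq
    have : (5 : ℝ) ≤ q := by exact_mod_cast h5
    nlinarith
  have hlog : 0 < Real.log Z := Real.log_pos hZ1
  have hsum : ∑ p ∈ A, Real.log p / p ≤ 4 * Real.log Z := by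
    calc ∑ p ∈ A, Real.log p / p
        ≤ ∑ p ∈ (Icc 1 ⌊Z ^ 2⌋₊).filter Nat.Prime, Real.log p / p := by
          refine sum_le_sum_of_subset_of_nonneg (fun p hp => ?_) fun p _ _ =>
            div_nonneg (Real.log_natCast_nonneg p) (Nat.cast_nonneg p)
          obtain ⟨h1, -, -, h4⟩ := hA p hp
          exact mem_filter.2 ⟨mem_Icc.2 ⟨h1.one_le, Nat.le_floor h4⟩, h1⟩
      _ ≤ 2 * Real.log ⌊Z ^ 2⌋₊ := sum_log_div_le _
      _ ≤ 2 * Real.log (Z ^ 2) := by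
          have h1 : 1 ≤ ⌊Z ^ 2⌋₊ := Nat.le_floor (by push_cast; nlinarith)
          have := Real.log_le_log (by exact_mod_cast h1) (Nat.floor_le (by positivity : 0 ≤ Z ^ 2))
          linarith
      _ = 4 * Real.log Z := by
          rw [Real.log_pow]
          push_cast
          ring
  have hterm : ∀ p ∈ A, (p : ℝ) / (p - 1) ≤ Real.exp (2 / Real.log Z * (Real.log p / p)) := by
    intro p hp
    obtain ⟨h1, h2, h3, -⟩ := hA p hp
    have h5 : (5 : ℝ) ≤ p := by exact_mod_cast h2
    have h6 : Real.log Z ≤ Real.log p := Real.log_le_log (by linarith) h3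
    have h7 : (p : ℝ) / (p - 1) ≤ 2 / p + 1 := by
      rw [div_add_one (by linarith), div_le_div_iff₀ (by linarith) (by linarith)]
      nlinarith
    refine h7.trans ((Real.add_one_le_exp _).trans (Real.exp_le_exp.2 ?_))
    rw [div_mul_div_comm, div_le_div_iff₀ (by linarith) (by positivity)]
    have : 2 * Real.log Z * p ≤ 2 * Real.log p * p := by gcongr
    linarith
  calc ∏ p ∈ A, ((p : ℝ) / (p - 1)) ≤ ∏ p ∈ A, Real.exp (2 / Real.log Z * (Real.log p / p)) := by
        refine prod_le_prod (fun p hp => ?_) hterm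
        linarith [one_le_div_sub_one (hA p hp).2.1]
    _ = Real.exp (2 / Real.log Z * ∑ p ∈ A, Real.log p / p) := by rw [← Real.exp_sum, mul_sum]
    _ ≤ Real.exp 8 := by
        refine Real.exp_le_exp.2 ?_
        rw [div_mul_eq_mul_div, div_le_iff₀ hlog]
        linarith

/-- The primes in `[5, y]` lying outside all the intervals `[Z i, Z i ^ 2]`. -/
noncomputable def siftingPrimes {m : ℕ} (Z : Fin m → ℝ) (y : ℕ) : Finset ℕ :=
  (Icc 1 y).filter fun p => p.Prime ∧ 5 ≤ p ∧ ∀ i, ¬ (Z i ≤ p ∧ (p : ℝ) ≤ Z i ^ 2)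

theorem log_le_prod_siftingPrimes {m : ℕ} {Z : Fin m → ℝ} (hZ : ∀ i, 1 ≤ Z i) (y : ℕ) :
    Real.log y ≤ 3 * Real.exp 8 ^ m * ∏ p ∈ siftingPrimes Z y, ((p : ℝ) / (p - 1)) := by
  set f : ℕ → ℝ := fun p => (p : ℝ) / (p - 1) with hf
  set S := (Icc 1 y).filter fun p => p.Prime ∧ 5 ≤ p with hS
  have hf1 : ∀ p ∈ S, 1 ≤ f p := fun p hp => one_le_div_sub_one (mem_filter.1 hp).2.2
  have hS0 : 0 ≤ ∏ p ∈ S, f p := prod_nonneg fun p hp => by linarith [hf1 p hp]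
  have hsmall : ∏ p ∈ ((Icc 1 y).filter Nat.Prime).filter (fun p => ¬ 5 ≤ p), f p ≤ 3 := by
    have hsub : ((Icc 1 y).filter Nat.Prime).filter (fun p => ¬ 5 ≤ p) ⊆ {2, 3} := by
      intro p hp
      obtain ⟨h1, h2⟩ := mem_filter.1 hp
      have h3 := (mem_filter.1 h1).2
      have : p < 5 := by omega
      interval_cases p <;> revert h3 <;> norm_num
    refine (prod_le_prod_of_subset_of_one_le hsub ?_ ?_).trans ?_
    · intro p hp
      have := hsub hp
      simp only [mem_insert, mem_singleton] at this
      rcases this with rfl | rfl <;> simp only [hf] <;> norm_num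
    · intro p hp _
      simp only [mem_insert, mem_singleton] at hp
      rcases hp with rfl | rfl <;> simp only [hf] <;> norm_num
    · rw [prod_pair (by norm_num)]
      simp only [hf]
      norm_num
  have hsplit : ∏ p ∈ S, f p ≤ (∏ p ∈ siftingPrimes Z y, f p) * Real.exp 8 ^ m := by
    have h1 : ∀ p ∈ S, f p ≤ (if ∀ i, ¬ (Z i ≤ p ∧ (p : ℝ) ≤ Z i ^ 2) then f p else 1) *
        ∏ i, if Z i ≤ p ∧ (p : ℝ) ≤ Z i ^ 2 then f p else 1 := by
      intro p hp
      have hp1 := hf1 p hp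
      have hprod : (1 : ℝ) ≤ ∏ i, if Z i ≤ p ∧ (p : ℝ) ≤ Z i ^ 2 then f p else 1 :=
        le_trans (by simp) (prod_le_prod (s := univ) (f := fun _ : Fin m => (1 : ℝ))
          (fun _ _ => zero_le_one) fun i _ => by split_ifs <;> simp [hp1])
      by_cases h : ∀ i, ¬ (Z i ≤ p ∧ (p : ℝ) ≤ Z i ^ 2)
      · rw [if_pos h]
        nlinarith
      · rw [if_neg h, one_mul]
        push Not at h
        obtain ⟨i, hi⟩ := h
        calc f p = if Z i ≤ p ∧ (p : ℝ) ≤ Z i ^ 2 then f p else 1 := (if_pos hi).symm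
          _ ≤ _ := by
            have := prod_le_prod_of_subset_of_one_le (s := {i}) (t := univ)
              (f := fun i => if Z i ≤ p ∧ (p : ℝ) ≤ Z i ^ 2 then f p else 1) (subset_univ _)
              (fun i _ => by split_ifs <;> linarith)
              (fun i _ _ => by split_ifs <;> linarith)
            simpa using this
    refine (prod_le_prod (fun p hp => by linarith [hf1 p hp]) h1).trans ?_
    rw [prod_mul_distrib, ← prod_filter, prod_comm]
    have h2 : S.filter (fun p : ℕ => ∀ i, ¬ (Z i ≤ (p : ℝ) ∧ (p : ℝ) ≤ Z i ^ 2)) =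
        siftingPrimes Z y := by
      rw [hS, siftingPrimes, filter_filter]
      simp only [and_assoc]
    rw [h2]
    refine mul_le_mul_of_nonneg_left ?_ (prod_nonneg fun p hp => ?_)
    · have h3 : ∀ i ∈ (univ : Finset (Fin m)),
          (∏ p ∈ S, if Z i ≤ p ∧ (p : ℝ) ≤ Z i ^ 2 then f p else 1) ≤ Real.exp 8 := by
        intro i _
        rw [← prod_filter]
        refine prod_primes_interval_le (hZ i) _ fun p hp => ?_
        obtain ⟨h4, h5⟩ := mem_filter.1 hp
        obtain ⟨h6, h7⟩ := (mem_filter.1 h4).2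
        exact ⟨h6, h7, h5⟩
      refine (prod_le_prod (fun i _ => prod_nonneg fun p hp => ?_) h3).trans ?_
      · have := hf1 p hp
        split_ifs <;> linarith
      · simp
    · have := one_le_div_sub_one (mem_filter.1 hp).2.2.1
      simp only [hf]
      linarith
  calc Real.log y ≤ ∏ p ∈ (Icc 1 y).filter Nat.Prime, f p := log_le_prod_primes y
    _ = (∏ p ∈ S, f p) *
        ∏ p ∈ ((Icc 1 y).filter Nat.Prime).filter (fun p => ¬ 5 ≤ p), f p := by
        rw [← prod_filter_mul_prod_filter_not _ (fun p => 5 ≤ p), filter_filter]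
    _ ≤ (∏ p ∈ S, f p) * 3 := mul_le_mul_of_nonneg_left hsmall hS0
    _ ≤ (∏ p ∈ siftingPrimes Z y, f p) * Real.exp 8 ^ m * 3 := by gcongr
    _ = _ := by ring

theorem sum_min_one_sq_le {x : ℝ} (hx : 0 < x) (J : ℕ) :
    ∑ j ∈ Icc 1 J, min 1 ((x / (j : ℝ)) ^ 2) ≤ 4 * x := by
  have key : ∑ j ∈ Icc 1 J, min 1 ((x / (j : ℝ)) ^ 2) ≤ 4 * x * J / (x + J) := by
    induction J with
    | zero => simp
    | succ n ih =>
      rw [sum_Icc_succ_top (by omega)]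
      have hn : (0 : ℝ) ≤ n := Nat.cast_nonneg n
      have h1 : min 1 ((x / ((n + 1 : ℕ) : ℝ)) ^ 2) ≤
          4 * x * x / ((x + (n + 1)) * (x + n)) := by
        push_cast
        rcases le_total ((n : ℝ) + 1) x with h | h
        · refine (min_le_left _ _).trans ?_
          rw [le_div_iff₀ (by positivity)]
          nlinarith
        · refine (min_le_right _ _).trans ?_
          rw [div_pow, div_le_div_iff₀ (by positivity) (by positivity)]
          have h2 : (x + (n + 1)) * (x + n) ≤ 4 * (n + 1 : ℝ) ^ 2 := by nlinarith
          nlinarith [mul_le_mul_of_nonneg_left h2 (sq_nonneg x)]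
      have h3 : 4 * x * ((n + 1 : ℕ) : ℝ) / (x + ((n + 1 : ℕ) : ℝ)) =
          4 * x * n / (x + n) + 4 * x * x / ((x + (n + 1)) * (x + n)) := by
        push_cast
        have : x + n ≠ 0 := by positivity
        have : x + (n + 1) ≠ 0 := by positivity
        field_simp
        ring
      rw [h3]
      exact add_le_add ih h1
  refine key.trans ?_
  rw [div_le_iff₀ (by positivity)]
  nlinarith [Nat.cast_nonneg (α := ℝ) J]

theorem sum_inv_sq_le_two (B : Finset ℕ) : ∑ p ∈ B, 1 / (p : ℝ) ^ 2 ≤ 2 := by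
  refine (sum_le_hasSum B (fun p _ => by positivity) hasSum_zeta_two).trans ?_
  nlinarith [Real.pi_lt_d2, Real.pi_pos]

/-- On average over `h`, the factor `∏ (1 + 3 / p)` over prime divisors of `h` is bounded. -/
theorem sum_prod_dvd_mul_min_le (B : Finset ℕ) (hB : ∀ p ∈ B, p.Prime) {H : ℝ} (hH : 0 < H)
    (N : ℕ) :
    ∑ h ∈ Icc 1 N, (∏ p ∈ B.filter (· ∣ h), (1 + 3 / (p : ℝ))) * min 1 ((H / (h : ℝ)) ^ 2) ≤
      4 * Real.exp 6 * H := by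
  have hexp : ∀ h : ℕ, ∏ p ∈ B.filter (· ∣ h), (1 + 3 / (p : ℝ)) =
      ∑ s ∈ B.powerset, if ∏ p ∈ s, p ∣ h then ∏ p ∈ s, 3 / (p : ℝ) else 0 := by
    intro h
    rw [prod_one_add, ← sum_filter]
    refine sum_congr ?_ fun _ _ => rfl
    ext s
    simp only [mem_powerset, mem_filter]
    constructor
    · intro hs
      have hsB : s ⊆ B := hs.trans (filter_subset _ _)
      refine ⟨hsB, prod_dvd_of_isRelPrime ?_ fun p hp => (mem_filter.1 (hs hp)).2⟩
      intro p hp q hq hpq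
      exact Nat.coprime_iff_isRelPrime.1
          ((Nat.coprime_primes (hB p (hsB hp)) (hB q (hsB hq))).2 hpq)
    · rintro ⟨h1, h2⟩ p hp
      exact mem_filter.2 ⟨h1 hp, (dvd_prod_of_mem _ hp).trans h2⟩
  have hin : ∀ s ∈ B.powerset, ∑ h ∈ Icc 1 N,
      (if ∏ p ∈ s, p ∣ h then ∏ p ∈ s, 3 / (p : ℝ) else 0) * min 1 ((H / (h : ℝ)) ^ 2) ≤
        4 * H * ∏ p ∈ s, 3 * (1 / (p : ℝ) ^ 2) := by
    intro s hs
    have hpos : ∀ p ∈ s, 0 < p := fun p hp => (hB p (mem_powerset.1 hs hp)).pos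
    set D := ∏ p ∈ s, p with hD
    have hD0 : 0 < D := prod_pos hpos
    have hD1 : (0 : ℝ) < D := by exact_mod_cast hD0
    have h1 : ∑ h ∈ (Icc 1 N).filter (D ∣ ·), min 1 ((H / (h : ℝ)) ^ 2) ≤ 4 * (H / D) := by
      refine le_trans ?_ (sum_min_one_sq_le (div_pos hH hD1) N)
      calc ∑ h ∈ (Icc 1 N).filter (D ∣ ·), min 1 ((H / (h : ℝ)) ^ 2)
          ≤ ∑ h ∈ (Icc 1 N).image (D * ·), min 1 ((H / (h : ℝ)) ^ 2) := by
            refine sum_le_sum_of_subset_of_nonneg (fun h hh => ?_) fun _ _ _ =>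
              le_min zero_le_one (sq_nonneg _)
            obtain ⟨h2, j, rfl⟩ := mem_filter.1 hh
            obtain ⟨h3, h4⟩ := mem_Icc.1 h2
            refine mem_image.2 ⟨j, mem_Icc.2 ⟨?_, ?_⟩, rfl⟩
            · exact Nat.pos_of_mul_pos_left h3
            · exact (Nat.le_mul_of_pos_left j hD0).trans h4
        _ = ∑ j ∈ Icc 1 N, min 1 ((H / D / (j : ℝ)) ^ 2) := by
            rw [sum_image fun a _ b _ hab => Nat.eq_of_mul_eq_mul_left hD0 hab]
            refine sum_congr rfl fun j _ => ?_
            push_cast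
            rw [div_div]
    have h2 : ∏ p ∈ s, 3 * (1 / (p : ℝ) ^ 2) = (∏ p ∈ s, 3 / (p : ℝ)) * (1 / D) := by
      rw [hD]
      push_cast
      rw [one_div, ← prod_inv_distrib, ← prod_mul_distrib]
      exact prod_congr rfl fun p _ => by ring
    have h3 : 0 ≤ ∏ p ∈ s, 3 / (p : ℝ) := prod_nonneg fun p _ => by positivity
    simp only [ite_mul, zero_mul]
    rw [← sum_filter, ← mul_sum, h2]
    calc _ ≤ (∏ p ∈ s, 3 / (p : ℝ)) * (4 * (H / D)) := mul_le_mul_of_nonneg_left h1 h3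
      _ = _ := by ring
  simp only [hexp, sum_mul]
  rw [sum_comm]
  refine (sum_le_sum hin).trans ?_
  rw [← mul_sum, ← prod_one_add]
  have h4 : ∏ p ∈ B, (1 + 3 * (1 / (p : ℝ) ^ 2)) ≤ Real.exp 6 := by
    calc ∏ p ∈ B, (1 + 3 * (1 / (p : ℝ) ^ 2))
        ≤ ∏ p ∈ B, Real.exp (3 * (1 / (p : ℝ) ^ 2)) :=
          prod_le_prod (fun p _ => by positivity) fun p _ => by
            rw [add_comm]
            exact Real.add_one_le_exp _
      _ = Real.exp (3 * ∑ p ∈ B, 1 / (p : ℝ) ^ 2) := by rw [← Real.exp_sum, mul_sum]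
      _ ≤ Real.exp 6 := Real.exp_le_exp.2 (by linarith [sum_inv_sq_le_two B])
  calc _ ≤ 4 * H * Real.exp 6 := by gcongr
    _ = _ := by ring

theorem card_filter_range_dvd {p : ℕ} (hp : 0 < p) :
    ((range p).filter fun k => p ∣ k).card = 1 := by
  rw [card_eq_one]
  refine ⟨0, ?_⟩
  ext k
  simp only [mem_filter, mem_range, mem_singleton]
  constructor
  · rintro ⟨h1, h2⟩
    exact Nat.eq_zero_of_dvd_of_lt h2 h1
  · rintro rfl
    exact ⟨hp, dvd_zero p⟩

theorem card_filter_range_dvd_linear {p : ℕ} (hp : p.Prime) {D : ℕ} (hD : ¬ p ∣ D) (h : ℤ) :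
    ((range p).filter fun k : ℕ => (p : ℤ) ∣ k * D + h).card = 1 := by
  have : Fact p.Prime := ⟨hp⟩
  have hD' : (D : ZMod p) ≠ 0 := by rwa [Ne, ZMod.natCast_eq_zero_iff]
  rw [card_eq_one]
  refine ⟨(-(h : ZMod p) * (D : ZMod p)⁻¹).val, ?_⟩
  ext k
  have h1 : (p : ℤ) ∣ k * D + h ↔ (k : ZMod p) = -(h : ZMod p) * (D : ZMod p)⁻¹ := by
    rw [← ZMod.intCast_zmod_eq_zero_iff_dvd]
    push_cast
    rw [eq_mul_inv_iff_mul_eq₀ hD', eq_neg_iff_add_eq_zero]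
  simp only [mem_filter, mem_range, mem_singleton, h1]
  constructor
  · rintro ⟨h2, h3⟩
    rw [← h3, ZMod.val_cast_of_lt h2]
  · rintro rfl
    exact ⟨ZMod.val_lt _, ZMod.natCast_zmod_val _⟩

theorem card_filter_range_dvd_or {p : ℕ} (hp : p.Prime) {D : ℕ} (hD : ¬ p ∣ D) {h : ℤ}
    (hh : ¬ (p : ℤ) ∣ h) :
    ((range p).filter fun k : ℕ => p ∣ k ∨ (p : ℤ) ∣ k * D + h).card = 2 := by
  rw [filter_or, card_union_of_disjoint, card_filter_range_dvd hp.pos,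
    card_filter_range_dvd_linear hp hD]
  refine disjoint_filter.2 fun k _ h1 h2 => hh ?_
  exact (Int.dvd_add_right ((Int.natCast_dvd_natCast.2 h1).mul_right _)).1 h2

/-- Selberg's sieve on the dyadic interval `[K, 2 * K)`. -/
theorem card_sifted_mul_prod_le {B : Finset ℕ} {y : ℕ} (hB : ∀ p ∈ B, p.Prime ∧ p ≤ y) {w : ℕ}
    (hw : ∀ p ∈ B, 2 * w ≤ p) (R : ℕ → ℕ → Prop) (hR : ∀ p ∈ B, ∀ k, R p (k % p) ↔ R p k)
    (hc : ∀ p ∈ B, ((range p).filter (R p)).card = w) {K : ℝ} (hK : 1 < K)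
    (hy : 16 * w * Real.log y ≤ Real.log K) (A : Finset ℕ)
    (hA : ∀ k ∈ A, K ≤ (k : ℝ) ∧ (k : ℝ) < 2 * K ∧ ∀ p ∈ B, ¬ R p k) :
    A.card * ∏ p ∈ B, ((p : ℝ) / (p - w)) ≤ 6 * K := by
  have hK0 : 0 < K := by linarith
  set z : ℝ := K ^ (1 / 4 : ℝ) with hz
  have hz1 : 1 < z := Real.one_lt_rpow hK (by norm_num)
  have hz4 : z ^ 4 = K := by
    rw [hz, ← Real.rpow_natCast, ← Real.rpow_mul hK0.le]
    norm_num
  have hlogz : Real.log z = 1 / 4 * Real.log K := Real.log_rpow hK0 _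
  have hprod : ∏ p ∈ B, ((p : ℝ) / (p - w)) ≤ 2 * sieveDenom w B z := by
    refine prod_le_two_mul_sieveDenom (fun p hp => (hB p hp).1) hw hz1 ?_
    have h1 : ∑ p ∈ B, Real.log p / p ≤ 2 * Real.log y :=
      (sum_le_sum_of_subset_of_nonneg (fun p hp => mem_filter.2
        ⟨mem_Icc.2 ⟨(hB p hp).1.one_le, (hB p hp).2⟩, (hB p hp).1⟩) fun p _ _ =>
          div_nonneg (Real.log_natCast_nonneg p) (Nat.cast_nonneg p)).trans (sum_log_div_le y)
    have h2 : ∑ p ∈ B, (w : ℝ) / p * Real.log p = w * ∑ p ∈ B, Real.log p / p := by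
      rw [mul_sum]
      exact sum_congr rfl fun p _ => by ring
    have h3 : (w : ℝ) * ∑ p ∈ B, Real.log p / p ≤ w * (2 * Real.log y) :=
      mul_le_mul_of_nonneg_left h1 (Nat.cast_nonneg w)
    rw [h2, hlogz]
    linarith
  have hL := one_le_sieveDenom hw hz1.le
  have hsub : A ⊆ (Ico ⌈K⌉₊ (⌈K⌉₊ + (⌈2 * K⌉₊ - ⌈K⌉₊))).filter fun k => ∀ p ∈ B, ¬ R p k := by
    intro k hk
    obtain ⟨h1, h2, h3⟩ := hA k hk
    refine mem_filter.2 ⟨mem_Ico.2 ⟨Nat.ceil_le.2 h1, ?_⟩, h3⟩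
    have := Nat.lt_ceil.2 h2
    omega
  have hN : ((⌈2 * K⌉₊ - ⌈K⌉₊ : ℕ) : ℝ) ≤ 2 * K := by
    have h1 : ⌈K⌉₊ ≤ ⌈2 * K⌉₊ := Nat.ceil_mono (by linarith)
    rw [Nat.cast_sub h1]
    have h2 := Nat.ceil_lt_add_one (a := 2 * K) (by linarith)
    have h3 := Nat.le_ceil K
    linarith
  have hsel := selberg_sieve_le (fun p hp => (hB p hp).1) hw R hR hc (by linarith : 0 ≤ z) ⌈K⌉₊
    (⌈2 * K⌉₊ - ⌈K⌉₊)
  have hcard : (A.card : ℝ) ≤ (((Ico ⌈K⌉₊ (⌈K⌉₊ + (⌈2 * K⌉₊ - ⌈K⌉₊))).filter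
      fun k => ∀ p ∈ B, ¬ R p k).card : ℝ) := by exact_mod_cast card_le_card hsub
  set L := sieveDenom w B z
  rw [hz4] at hsel
  have h1 : (A.card : ℝ) * L ^ 2 ≤ 3 * K * L := by
    have h2 : (A.card : ℝ) * L ^ 2 ≤ _ := mul_le_mul_of_nonneg_right hcard (sq_nonneg L)
    nlinarith
  have h2 : (A.card : ℝ) * L ≤ 3 * K := by
    refine le_of_mul_le_mul_right (a := L) ?_ (by linarith)
    linarith
  have h3 : (A.card : ℝ) * ∏ p ∈ B, ((p : ℝ) / (p - w)) ≤ A.card * (2 * L) :=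
    mul_le_mul_of_nonneg_left hprod (Nat.cast_nonneg _)
  linarith

theorem card_mul_prod_le {B : Finset ℕ} {y : ℕ} (hB : ∀ p ∈ B, p.Prime ∧ p ≤ y)
    {K : ℝ} (hK : 1 < K) (hy : 16 * Real.log y ≤ Real.log K) (A : Finset ℕ)
    (hA : ∀ k ∈ A, K ≤ (k : ℝ) ∧ (k : ℝ) < 2 * K ∧ ∀ p ∈ B, ¬ p ∣ k) :
    A.card * ∏ p ∈ B, ((p : ℝ) / (p - 1)) ≤ 6 * K := by
  have := card_sifted_mul_prod_le hB (w := 1) (fun p hp => (hB p hp).1.two_le) (fun p k => p ∣ k)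
    (fun p _ k => Nat.dvd_mod_iff dvd_rfl)
        (fun p hp => by convert card_filter_range_dvd (hB p hp).1.pos) hK
    (by simpa using hy) A hA
  simpa using this

/-- Upper bound for the number of `k ∈ [K, 2 * K)` such that `k` and `k * D + h` are both free of
the primes in `B`. -/
theorem card_mul_prod_sq_le {B : Finset ℕ} {y : ℕ} (hB : ∀ p ∈ B, p.Prime ∧ p ≤ y)
    (hB5 : ∀ p ∈ B, 5 ≤ p) {K : ℝ} (hK : 1 < K) (hy : 32 * Real.log y ≤ Real.log K) {D : ℕ}
    (hD : ∀ p ∈ B, ¬ p ∣ D) (h : ℤ) (A : Finset ℕ)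
    (hA : ∀ k ∈ A, K ≤ (k : ℝ) ∧ (k : ℝ) < 2 * K ∧ ∀ p ∈ B, ¬ p ∣ k ∧ ¬ (p : ℤ) ∣ k * D + h) :
    A.card * (∏ p ∈ B, ((p : ℝ) / (p - 1))) ^ 2 ≤
      6 * K * ∏ p ∈ B.filter (· ∣ h.natAbs), (1 + 3 / (p : ℝ)) := by
  set B' := B.filter fun p => ¬ p ∣ h.natAbs with hB'
  have hsub : ∀ p ∈ B', p ∈ B := fun p hp => (mem_filter.1 hp).1
  have h1 := card_sifted_mul_prod_le (B := B') (fun p hp => hB p (hsub p hp)) (w := 2)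
    (fun p hp => by have := hB5 p (hsub p hp); omega)
    (fun p k => p ∣ k ∨ (p : ℤ) ∣ k * D + h)
    (fun p _ k => by
      refine or_congr (Nat.dvd_mod_iff dvd_rfl) ?_
      have h2 : ((k % p : ℕ) : ℤ) ≡ k [ZMOD p] := by
        push_cast
        exact Int.mod_modEq _ _
      have h3 := (h2.mul_right (D : ℤ)).add_right h
      rw [Int.dvd_iff_emod_eq_zero, Int.dvd_iff_emod_eq_zero, h3.eq])
    (fun p hp => by
      have h2 : ¬ (p : ℤ) ∣ h := by
        rw [Int.natCast_dvd]
        exact (mem_filter.1 hp).2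
      convert card_filter_range_dvd_or (hB p (hsub p hp)).1 (hD p (hsub p hp)) h2) hK
          (by push_cast; linarith) A
    (fun k hk => ⟨(hA k hk).1, (hA k hk).2.1, fun p hp => not_or.2 ((hA k hk).2.2 p (hsub p hp))⟩)
  have hp5 : ∀ p ∈ B, (5 : ℝ) ≤ p := fun p hp => by exact_mod_cast hB5 p hp
  have h2 : (∏ p ∈ B, ((p : ℝ) / (p - 1))) ^ 2 ≤ (∏ p ∈ B', ((p : ℝ) / (p - (2 : ℕ)))) *
      ∏ p ∈ B.filter (· ∣ h.natAbs), (1 + 3 / (p : ℝ)) := by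
    rw [← prod_pow, ← prod_filter_mul_prod_filter_not B (· ∣ h.natAbs), mul_comm]
    refine mul_le_mul (prod_le_prod (fun _ _ => sq_nonneg _) fun p hp => ?_)
      (prod_le_prod (fun _ _ => sq_nonneg _) fun p hp => ?_)
      (prod_nonneg fun _ _ => sq_nonneg _) (prod_nonneg fun p hp => ?_)
    · have := hp5 p (mem_filter.1 hp).1
      push_cast
      rw [div_pow, div_le_div_iff₀ (by nlinarith) (by linarith)]
      nlinarith
    · have := hp5 p (mem_filter.1 hp).1
      rw [div_pow, one_add_div (by linarith), div_le_div_iff₀ (by nlinarith) (by linarith)]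
      nlinarith
    · have := hp5 p (hsub p hp)
      push_cast
      exact div_nonneg (by linarith) (by linarith)
  have h3 : 0 ≤ ∏ p ∈ B.filter (· ∣ h.natAbs), (1 + 3 / (p : ℝ)) :=
    prod_nonneg fun p _ => by positivity
  calc (A.card : ℝ) * (∏ p ∈ B, ((p : ℝ) / (p - 1))) ^ 2
      ≤ A.card * ((∏ p ∈ B', ((p : ℝ) / (p - (2 : ℕ)))) *
        ∏ p ∈ B.filter (· ∣ h.natAbs), (1 + 3 / (p : ℝ))) := by gcongr
    _ = A.card * (∏ p ∈ B', ((p : ℝ) / (p - (2 : ℕ)))) *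
        ∏ p ∈ B.filter (· ∣ h.natAbs), (1 + 3 / (p : ℝ)) := by ring
    _ ≤ _ := mul_le_mul_of_nonneg_right h1 h3

/-- The integral over `[0, 2 * T]` of a character of the real line. -/
noncomputable def charIntegral (T θ : ℝ) : ℂ :=
  ∫ u in (0 : ℝ)..(2 * T), Complex.exp ((u * θ : ℝ) * Complex.I)

theorem norm_charIntegral_le {T : ℝ} (hT : 0 ≤ T) (θ : ℝ) : ‖charIntegral T θ‖ ≤ 2 * T := by
  have := intervalIntegral.norm_integral_le_of_norm_le_const (a := (0 : ℝ)) (b := 2 * T) (C := 1)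
    (f := fun u : ℝ => Complex.exp ((u * θ : ℝ) * Complex.I)) fun u _ => by
      rw [Complex.norm_exp_ofReal_mul_I]
  rwa [sub_zero, one_mul, abs_of_nonneg (by linarith)] at this

theorem norm_charIntegral_le_div (T : ℝ) {θ : ℝ} (hθ : θ ≠ 0) :
    ‖charIntegral T θ‖ ≤ 2 / |θ| := by
  have hc : (θ : ℂ) * Complex.I ≠ 0 := mul_ne_zero (by exact_mod_cast hθ) Complex.I_ne_zero
  have h1 : charIntegral T θ =
      (Complex.exp ((2 * T * θ : ℝ) * Complex.I) - 1) / (θ * Complex.I) := by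
    have := integral_exp_mul_complex (a := 0) (b := 2 * T) hc
    rw [charIntegral]
    convert this using 2
    · funext u
      push_cast
      ring_nf
    · push_cast
      simp only [mul_zero, Complex.exp_zero]
      ring_nf
  rw [h1, norm_div, norm_mul, Complex.norm_I, mul_one, Complex.norm_real, Real.norm_eq_abs]
  gcongr
  refine (norm_sub_le _ _).trans ?_
  rw [Complex.norm_exp_ofReal_mul_I, norm_one]
  norm_num

theorem mul_integral_le_integral_integral_sub {G : ℝ → ℝ} (hG : Continuous G) (h0 : ∀ t, 0 ≤ G t)
    {T : ℝ} (hT : 0 ≤ T) :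
    T * ∫ t in (0 : ℝ)..T, G t ≤
      ∫ u in (0 : ℝ)..(2 * T), ∫ v in (0 : ℝ)..(2 * T), G (u - v) := by
  have hcont : Continuous fun u => ∫ v in (0 : ℝ)..(2 * T), G (u - v) := by
    refine intervalIntegral.continuous_parametric_intervalIntegral_of_continuous' ?_ _ _
    exact hG.comp (continuous_fst.sub continuous_snd)
  have hnn : ∀ u, 0 ≤ ∫ v in (0 : ℝ)..(2 * T), G (u - v) := fun u =>
    intervalIntegral.integral_nonneg (by linarith) fun v _ => h0 _
  have h1 : ∀ u ∈ Set.Icc T (2 * T), ∫ t in (0 : ℝ)..T, G t ≤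
      ∫ v in (0 : ℝ)..(2 * T), G (u - v) := by
    rintro u ⟨hu1, hu2⟩
    rw [intervalIntegral.integral_comp_sub_left fun x => G x]
    refine intervalIntegral.integral_mono_interval (by linarith) hT (by linarith) ?_
      (hG.intervalIntegrable _ _)
    exact Filter.Eventually.of_forall fun t => h0 t
  calc T * ∫ t in (0 : ℝ)..T, G t = ∫ _ in T..(2 * T), ∫ t in (0 : ℝ)..T, G t := by
        rw [intervalIntegral.integral_const, smul_eq_mul]
        ring
    _ ≤ ∫ u in T..(2 * T), ∫ v in (0 : ℝ)..(2 * T), G (u - v) :=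
        intervalIntegral.integral_mono_on (by linarith) (continuous_const.intervalIntegrable _ _)
          (hcont.intervalIntegrable _ _) h1
    _ ≤ _ := by
        refine intervalIntegral.integral_mono_interval hT (by linarith) le_rfl ?_
          (hcont.intervalIntegrable _ _)
        exact Filter.Eventually.of_forall fun t => hnn t

/-- A mean value estimate for exponential sums, by Fejér smoothing. -/
theorem mul_integral_norm_sq_le {ι : Type*} (s : Finset ι) (c : ι → ℂ) (θ : ι → ℝ) {T : ℝ}
    (hT : 0 ≤ T) :
    T * ∫ t in (0 : ℝ)..T, ‖∑ i ∈ s, c i * Complex.exp ((t * θ i : ℝ) * Complex.I)‖ ^ 2 ≤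
      ∑ i ∈ s, ∑ j ∈ s, ‖c i‖ * ‖c j‖ *
        (‖charIntegral T (θ i - θ j)‖ * ‖charIntegral T (θ j - θ i)‖) := by
  set F : ℝ → ℂ := fun t => ∑ i ∈ s, c i * Complex.exp ((t * θ i : ℝ) * Complex.I) with hF
  have hFc : Continuous F := by
    refine continuous_finsetSum _ fun i _ => ?_
    fun_prop
  refine (mul_integral_le_integral_integral_sub (G := fun t => ‖F t‖ ^ 2) (by fun_prop)
    (fun t => sq_nonneg _) hT).trans ?_
  have hexp : ∀ u v : ℝ, ((‖F (u - v)‖ ^ 2 : ℝ) : ℂ) = ∑ i ∈ s, ∑ j ∈ s,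
      c i * (starRingEnd ℂ) (c j) * Complex.exp ((u * (θ i - θ j) : ℝ) * Complex.I) *
        Complex.exp ((v * (θ j - θ i) : ℝ) * Complex.I) := by
    intro u v
    push_cast
    rw [← Complex.mul_conj', hF]
    simp only [map_sum, map_mul, sum_mul_sum, ← Complex.exp_conj, Complex.conj_ofReal,
      Complex.conj_I]
    refine sum_congr rfl fun i _ => sum_congr rfl fun j _ => ?_
    rw [mul_assoc (c i * _), ← Complex.exp_add, mul_mul_mul_comm, ← Complex.exp_add]
    congr 2
    push_cast
    ring
  have hval : ((∫ u in (0 : ℝ)..(2 * T), ∫ v in (0 : ℝ)..(2 * T), ‖F (u - v)‖ ^ 2 : ℝ) : ℂ) =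
      ∑ i ∈ s, ∑ j ∈ s, c i * (starRingEnd ℂ) (c j) * charIntegral T (θ i - θ j) *
        charIntegral T (θ j - θ i) := by
    rw [← intervalIntegral.integral_ofReal]
    simp only [← intervalIntegral.integral_ofReal, hexp]
    have hin : ∀ u : ℝ, (∫ v in (0 : ℝ)..(2 * T), ∑ i ∈ s, ∑ j ∈ s,
        c i * (starRingEnd ℂ) (c j) * Complex.exp ((u * (θ i - θ j) : ℝ) * Complex.I) *
          Complex.exp ((v * (θ j - θ i) : ℝ) * Complex.I)) = ∑ i ∈ s, ∑ j ∈ s,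
        c i * (starRingEnd ℂ) (c j) * charIntegral T (θ j - θ i) *
          Complex.exp ((u * (θ i - θ j) : ℝ) * Complex.I) := by
      intro u
      rw [intervalIntegral.integral_finsetSum fun i _ =>
        Continuous.intervalIntegrable (by fun_prop) _ _]
      refine sum_congr rfl fun i _ => ?_
      rw [intervalIntegral.integral_finsetSum fun j _ =>
        Continuous.intervalIntegrable (by fun_prop) _ _]
      refine sum_congr rfl fun j _ => ?_
      rw [intervalIntegral.integral_const_mul, charIntegral]
      ring
    simp only [hin]
    rw [intervalIntegral.integral_finsetSum fun i _ =>
      Continuous.intervalIntegrable (by fun_prop) _ _]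
    refine sum_congr rfl fun i _ => ?_
    rw [intervalIntegral.integral_finsetSum fun j _ =>
      Continuous.intervalIntegrable (by fun_prop) _ _]
    refine sum_congr rfl fun j _ => ?_
    rw [intervalIntegral.integral_const_mul, ← charIntegral]
    ring
  calc (∫ u in (0 : ℝ)..(2 * T), ∫ v in (0 : ℝ)..(2 * T), ‖F (u - v)‖ ^ 2)
      ≤ ‖((∫ u in (0 : ℝ)..(2 * T), ∫ v in (0 : ℝ)..(2 * T), ‖F (u - v)‖ ^ 2 : ℝ) : ℂ)‖ := by
        rw [Complex.norm_real]
        exact Real.le_norm_self _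
    _ ≤ _ := by
        rw [hval]
        refine (norm_sum_le _ _).trans (sum_le_sum fun i _ => (norm_sum_le _ _).trans
          (sum_le_sum fun j _ => ?_))
        rw [norm_mul, norm_mul, norm_mul, RCLike.norm_conj, mul_assoc]

theorem sum_factorization_mul {J : Finset ℕ} {a b : ℕ} (ha : a ≠ 0) (hb : b ≠ 0) :
    ∑ p ∈ J, (a * b).factorization p =
      ∑ p ∈ J, a.factorization p + ∑ p ∈ J, b.factorization p := by
  rw [Nat.factorization_mul ha hb, ← sum_add_distrib]
  rfl

theorem sum_factorization_prime {J : Finset ℕ} {q : ℕ} (hq : q.Prime) (hqJ : q ∈ J) :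
    ∑ p ∈ J, q.factorization p = 1 := by
  simp [hq.factorization, Finsupp.single_apply, hqJ]

theorem sum_factorization_prod {J : Finset ℕ} (hJ : ∀ p ∈ J, p.Prime) {n : ℕ} (v : Fin n → ℕ)
    (hv : ∀ i, v i ∈ J) : ∑ p ∈ J, (∏ i, v i).factorization p = n := by
  induction n with
  | zero => simp
  | succ n ih =>
    rw [Fin.prod_univ_succ, sum_factorization_mul (hJ _ (hv 0)).ne_zero
      (prod_ne_zero_iff.2 fun i _ => (hJ _ (hv _)).ne_zero),
      sum_factorization_prime (hJ _ (hv 0)) (hv 0), ih _ fun i => hv _]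
    ring

/-- The number of `n`-tuples of primes from `J` whose product divides `m`. -/
theorem card_tuples_dvd_le {J : Finset ℕ} (hJ : ∀ p ∈ J, p.Prime) (n : ℕ) :
    ∀ {m R : ℕ}, m ≠ 0 → ∑ p ∈ J, m.factorization p ≤ R →
      ((Fintype.piFinset fun _ : Fin n => J).filter fun v => ∏ i, v i ∣ m).card ≤ R.factorial := by
  induction n with
  | zero =>
    intro m R _ _
    refine le_trans (card_le_one.2 fun a _ b _ => Subsingleton.elim a b) R.factorial_pos
  | succ n ih =>
    intro m R hm hR
    set T : ℕ → Finset (Fin n → ℕ) := fun p =>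
      (Fintype.piFinset fun _ : Fin n => J).filter fun v => ∏ i, v i ∣ m / p with hT
    have h1 : ((Fintype.piFinset fun _ : Fin (n + 1) => J).filter fun v => ∏ i, v i ∣ m).card ≤
        ((J.filter (· ∣ m)).sigma T).card := by
      refine card_le_card_of_injOn (fun v => ⟨v 0, fun i => v i.succ⟩) ?_ ?_
      · intro v hv
        obtain ⟨h2, h3⟩ := mem_filter.1 (mem_coe.1 hv)
        rw [Fin.prod_univ_succ] at h3
        have h4 := Fintype.mem_piFinset.1 h2
        refine mem_coe.2 (mem_sigma.2 ⟨mem_filter.2 ⟨h4 0, (Dvd.intro _ rfl).trans h3⟩,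
          mem_filter.2 ⟨Fintype.mem_piFinset.2 fun i => h4 _, ?_⟩⟩)
        exact Nat.dvd_div_of_mul_dvd h3
      · intro v _ w _ hvw
        simp only [Sigma.mk.injEq, heq_eq_eq] at hvw
        funext i
        refine Fin.cases hvw.1 (fun j => ?_) i
        exact congrFun hvw.2 j
    refine h1.trans ?_
    rw [card_sigma]
    have hcard : (J.filter (· ∣ m)).card ≤ R := by
      refine le_trans ?_ hR
      rw [card_eq_sum_ones]
      calc ∑ p ∈ J.filter (· ∣ m), 1 ≤ ∑ p ∈ J.filter (· ∣ m), m.factorization p :=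
            sum_le_sum fun p hp => (hJ p (mem_filter.1 hp).1).factorization_pos_of_dvd hm
              (mem_filter.1 hp).2
        _ ≤ _ := sum_le_sum_of_subset (filter_subset _ _)
    rcases R with _ | R
    · rw [card_eq_zero.1 (Nat.le_zero.1 hcard)]
      simp
    · have h5 : ∀ p ∈ J.filter (· ∣ m), (T p).card ≤ R.factorial := by
        intro p hp
        obtain ⟨hpJ, q, rfl⟩ := mem_filter.1 hp
        have hp0 := (hJ p hpJ).pos
        have hq : q ≠ 0 := right_ne_zero_of_mul hm
        simp only [hT, Nat.mul_div_cancel_left q hp0]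
        refine ih hq ?_
        rw [sum_factorization_mul hp0.ne' hq, sum_factorization_prime (hJ p hpJ) hpJ] at hR
        omega
      calc ∑ p ∈ J.filter (· ∣ m), (T p).card ≤ (J.filter (· ∣ m)).card * R.factorial := by
            simpa using sum_le_card_nsmul _ _ _ h5
        _ ≤ (R + 1) * R.factorial := Nat.mul_le_mul_right _ hcard
        _ = _ := (Nat.factorial_succ R).symm

/-- The number of representations of `m` as an element of `A` times `n` primes from `J`. -/
theorem card_factorizations_le {A J : Finset ℕ} (hJ : ∀ p ∈ J, p.Prime) {r : ℕ}
    (hA : ∀ k ∈ A, k ≠ 0 ∧ ∑ p ∈ J, k.factorization p ≤ r) (n m : ℕ) :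
    ((A ×ˢ Fintype.piFinset fun _ : Fin n => J).filter fun x => x.1 * ∏ i, x.2 i = m).card ≤
      (n + r).factorial := by
  set S := (A ×ˢ Fintype.piFinset fun _ : Fin n => J).filter fun x => x.1 * ∏ i, x.2 i = m
  rcases S.eq_empty_or_nonempty with h0 | ⟨x, hx⟩
  · simp [h0]
  have hmem : ∀ x ∈ S, x.1 ∈ A ∧ (∀ i, x.2 i ∈ J) ∧ x.1 * ∏ i, x.2 i = m := by
    intro x hx
    obtain ⟨h1, h2⟩ := mem_filter.1 hx
    obtain ⟨h3, h4⟩ := mem_product.1 h1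
    exact ⟨h3, Fintype.mem_piFinset.1 h4, h2⟩
  have hpos : ∀ x ∈ S, ∏ i, x.2 i ≠ 0 := fun x hx =>
    prod_ne_zero_iff.2 fun i _ => (hJ _ ((hmem x hx).2.1 i)).ne_zero
  have hm : m ≠ 0 := by
    rw [← (hmem x hx).2.2]
    exact mul_ne_zero (hA _ (hmem x hx).1).1 (hpos x hx)
  refine le_trans ?_ (card_tuples_dvd_le hJ n (m := m) (R := n + r) hm ?_)
  · refine card_le_card_of_injOn Prod.snd ?_ ?_
    · intro y hy
      obtain ⟨-, h2, h3⟩ := hmem y (mem_coe.1 hy)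
      exact mem_coe.2 (mem_filter.2 ⟨Fintype.mem_piFinset.2 h2, Dvd.intro_left _ h3⟩)
    · intro y hy z hz hyz
      have h3 := (hmem y (mem_coe.1 hy)).2.2.trans (hmem z (mem_coe.1 hz)).2.2.symm
      have h4 := hpos z (mem_coe.1 hz)
      rw [hyz] at h3
      exact Prod.ext (mul_right_cancel₀ h4 h3) hyz
  · obtain ⟨h1, h2, h3⟩ := hmem x hx
    rw [← h3, sum_factorization_mul (hA _ h1).1 (hpos x hx), sum_factorization_prod hJ _ h2]
    linarith [(hA _ h1).2]

/-- The off-diagonal contribution: pairs `(k, m)` with `m ≠ k * D`, where `k` and `m` are free of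
the primes in `B`, weighted by the distance of `m` to `k * D`. -/
theorem sum_off_diagonal_le {B : Finset ℕ} {y : ℕ} (hB : ∀ p ∈ B, p.Prime ∧ p ≤ y)
    (hB5 : ∀ p ∈ B, 5 ≤ p) {K : ℝ} (hK : 1 < K) (hy : 32 * Real.log y ≤ Real.log K) {D : ℕ}
    (hD : ∀ p ∈ B, ¬ p ∣ D) {A E : Finset ℕ}
    (hA : ∀ k ∈ A, K ≤ (k : ℝ) ∧ (k : ℝ) < 2 * K ∧ ∀ p ∈ B, ¬ p ∣ k)
    (hE : ∀ m ∈ E, ∀ p ∈ B, ¬ p ∣ m) {H : ℝ} (hH : 0 < H) :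
    (∑ k ∈ A, ∑ m ∈ E.filter fun m => m ≠ k * D,
        min 1 ((H / (((m : ℤ) - (k * D : ℕ)).natAbs : ℝ)) ^ 2)) *
      (∏ p ∈ B, ((p : ℝ) / (p - 1))) ^ 2 ≤ 48 * Real.exp 6 * K * H := by
  set V := ∏ p ∈ B, ((p : ℝ) / (p - 1)) with hV
  set ψ : ℕ → ℝ := fun h => min 1 ((H / (h : ℝ)) ^ 2) with hψ
  have hψ0 : ∀ h, 0 ≤ ψ h := fun h => le_min zero_le_one (sq_nonneg _)
  set N := E.sup id + A.sup id * D with hN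
  set Q : Finset (ℕ × ℤ) := Icc 1 N ×ˢ ({1, -1} : Finset ℤ) with hQ
  set g : ℕ → ℕ × ℤ → ℝ := fun k q =>
    if ∀ p ∈ B, ¬ (p : ℤ) ∣ k * D + q.2 * q.1 then ψ q.1 else 0 with hg
  have hinner : ∀ k ∈ A, ∑ m ∈ E.filter (fun m => m ≠ k * D), ψ ((m : ℤ) - (k * D : ℕ)).natAbs ≤
      ∑ q ∈ Q, g k q := by
    intro k hk
    set e : ℕ → ℕ × ℤ := fun m => (((m : ℤ) - (k * D : ℕ)).natAbs, ((m : ℤ) - (k * D : ℕ)).sign)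
      with he
    have hrec : ∀ m : ℕ, (e m).2 * (e m).1 = (m : ℤ) - (k * D : ℕ) := fun m =>
      Int.sign_mul_natAbs _
    have hinj : ∀ a b : ℕ, e a = e b → a = b := by
      intro a b hab
      have h1 := hrec a
      rw [hab, hrec b] at h1
      omega
    have hmemQ : ∀ m ∈ E.filter (fun m => m ≠ k * D), e m ∈ Q := by
      intro m hm
      obtain ⟨h1, h2⟩ := mem_filter.1 hm
      have h3 : (m : ℤ) - (k * D : ℕ) ≠ 0 := by omega
      refine mem_product.2 ⟨mem_Icc.2 ⟨Int.natAbs_pos.2 h3, ?_⟩, ?_⟩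
      · have h4 : m ≤ E.sup id := le_sup (f := id) h1
        have h5 : k * D ≤ A.sup id * D := Nat.mul_le_mul_right _ (le_sup (f := id) hk)
        simp only [he, hN]
        omega
      · simp only [he, mem_insert, mem_singleton]
        rcases lt_or_gt_of_ne h3 with h | h
        · exact Or.inr (Int.sign_eq_neg_one_of_neg h)
        · exact Or.inl (Int.sign_eq_one_of_pos h)
    calc ∑ m ∈ E.filter (fun m => m ≠ k * D), ψ ((m : ℤ) - (k * D : ℕ)).natAbs
        = ∑ m ∈ E.filter (fun m => m ≠ k * D),
            g k (e m) := by
          refine sum_congr rfl fun m hm => ?_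
          simp only [hg]
          rw [if_pos]
          intro p hp hdvd
          rw [hrec m] at hdvd
          push_cast at hdvd
          rw [add_sub_cancel] at hdvd
          exact hE m (mem_filter.1 hm).1 p hp (Int.natCast_dvd_natCast.1 hdvd)
      _ = ∑ q ∈ (E.filter (fun m => m ≠ k * D)).image e, g k q :=
          (sum_image fun a _ b _ h => hinj a b h).symm
      _ ≤ _ := by
          refine sum_le_sum_of_subset_of_nonneg (image_subset_iff.2 hmemQ) fun q _ _ => ?_
          simp only [hg]
          split_ifs
          · exact hψ0 _
          · exact le_rfl
  have hcount : ∀ q ∈ Q, (∑ k ∈ A, g k q) * V ^ 2 ≤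
      6 * K * ((∏ p ∈ B.filter (· ∣ q.1), (1 + 3 / (p : ℝ))) * ψ q.1) := by
    intro q hq
    have h1 : (q.2 * q.1 : ℤ).natAbs = q.1 := by
      have := (mem_product.1 hq).2
      simp only [mem_insert, mem_singleton] at this
      rcases this with h | h <;> rw [h, Int.natAbs_mul] <;> simp
    have h2 := card_mul_prod_sq_le hB hB5 hK hy hD (q.2 * q.1)
      (A.filter fun k : ℕ => ∀ p ∈ B, ¬ (p : ℤ) ∣ k * D + q.2 * q.1) fun k hk => by
        obtain ⟨h3, h4⟩ := mem_filter.1 hk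
        obtain ⟨h5, h6, h7⟩ := hA k h3
        exact ⟨h5, h6, fun p hp => ⟨h7 p hp, h4 p hp⟩⟩
    rw [h1] at h2
    have h3 : ∑ k ∈ A, g k q =
        ((A.filter fun k : ℕ => ∀ p ∈ B, ¬ (p : ℤ) ∣ k * D + q.2 * q.1).card : ℝ) * ψ q.1 := by
      simp only [hg]
      rw [← sum_filter, sum_const, nsmul_eq_mul]
    rw [h3]
    calc _ = (((A.filter fun k : ℕ => ∀ p ∈ B, ¬ (p : ℤ) ∣ k * D + q.2 * q.1).card : ℝ) * V ^ 2) *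
          ψ q.1 := by ring
      _ ≤ _ := mul_le_mul_of_nonneg_right h2 (hψ0 _)
      _ = _ := by ring
  calc (∑ k ∈ A, ∑ m ∈ E.filter fun m => m ≠ k * D, ψ ((m : ℤ) - (k * D : ℕ)).natAbs) * V ^ 2
      ≤ (∑ k ∈ A, ∑ q ∈ Q, g k q) * V ^ 2 :=
        mul_le_mul_of_nonneg_right (sum_le_sum hinner) (sq_nonneg V)
    _ = ∑ q ∈ Q, (∑ k ∈ A, g k q) * V ^ 2 := by
        rw [sum_comm, sum_mul]
    _ ≤ ∑ q ∈ Q, 6 * K * ((∏ p ∈ B.filter (· ∣ q.1), (1 + 3 / (p : ℝ))) * ψ q.1) :=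
        sum_le_sum hcount
    _ = 6 * K * (2 * ∑ h ∈ Icc 1 N, (∏ p ∈ B.filter (· ∣ h), (1 + 3 / (p : ℝ))) * ψ h) := by
        rw [← mul_sum, hQ, sum_product]
        congr 1
        rw [mul_sum]
        refine sum_congr rfl fun h _ => ?_
        rw [sum_pair (by norm_num), two_mul]
    _ ≤ 6 * K * (2 * (4 * Real.exp 6 * H)) := by
        have := sum_prod_dvd_mul_min_le B (fun p hp => (hB p hp).1) hH N
        have hK0 : 0 ≤ K := by linarith
        gcongr
    _ = _ := by ring

/-- The kernel weight attached to a pair of integers in the mean value estimate. -/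
noncomputable def pairWeight (H : ℝ) (m n : ℕ) : ℝ :=
  if m = n then 1 else min 1 ((H / (((m : ℤ) - n).natAbs : ℝ)) ^ 2)

theorem pairWeight_nonneg (H : ℝ) (m n : ℕ) : 0 ≤ pairWeight H m n := by
  unfold pairWeight
  split_ifs
  · exact zero_le_one
  · exact le_min zero_le_one (sq_nonneg _)

theorem abs_sub_div_le_abs_log_sub {m n : ℕ} (hm : 0 < m) (hn : 0 < n) {U : ℝ}
    (hmU : (m : ℝ) ≤ U) (hnU : (n : ℝ) ≤ U) :
    |(m : ℝ) - n| / U ≤ |Real.log m - Real.log n| := by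
  wlog h : n ≤ m generalizing m n
  · rw [abs_sub_comm, abs_sub_comm (Real.log m)]
    exact this hn hm hnU hmU (by omega)
  have hm' : (0 : ℝ) < m := by exact_mod_cast hm
  have hn' : (0 : ℝ) < n := by exact_mod_cast hn
  have h' : (n : ℝ) ≤ m := by exact_mod_cast h
  rw [abs_of_nonneg (by linarith), abs_of_nonneg (by linarith [Real.log_le_log hn' h']),
    ← Real.log_div hm'.ne' hn'.ne']
  refine le_trans ?_ (Real.one_sub_inv_le_log_of_pos (by positivity))
  rw [inv_div, one_sub_div hm'.ne']
  gcongr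

theorem charIntegral_mul_le_pairWeight {m n : ℕ} (hm : 0 < m) (hn : 0 < n) {T U : ℝ} (hT : 0 < T)
    (hmU : (m : ℝ) ≤ U) (hnU : (n : ℝ) ≤ U) :
    ‖charIntegral T (Real.log m - Real.log n)‖ * ‖charIntegral T (Real.log n - Real.log m)‖ ≤
      4 * T ^ 2 * pairWeight (U / T) m n := by
  have h1 : ‖charIntegral T (Real.log m - Real.log n)‖ *
      ‖charIntegral T (Real.log n - Real.log m)‖ ≤ (2 * T) * (2 * T) :=
    mul_le_mul (norm_charIntegral_le hT.le _) (norm_charIntegral_le hT.le _) (norm_nonneg _)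
      (by linarith)
  unfold pairWeight
  split_ifs with h
  · linarith
  have hm' : (0 : ℝ) < m := by exact_mod_cast hm
  have hn' : (0 : ℝ) < n := by exact_mod_cast hn
  have hU : 0 < U := by linarith
  have hab : ((((m : ℤ) - n).natAbs : ℕ) : ℝ) = |(m : ℝ) - n| := by
    rw [Nat.cast_natAbs]
    push_cast
    rfl
  have hd : 0 < |(m : ℝ) - n| := abs_pos.2 (sub_ne_zero.2 (by exact_mod_cast h))
  have hl := abs_sub_div_le_abs_log_sub hm hn hmU hnU
  have hl0 : 0 < |(m : ℝ) - n| / U := by positivity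
  have hne : Real.log m - Real.log n ≠ 0 := abs_pos.1 (hl0.trans_le hl)
  have hne' : Real.log n - Real.log m ≠ 0 := by
    rw [← neg_sub]
    exact neg_ne_zero.2 hne
  have h2 : ∀ θ : ℝ, |θ| = |Real.log m - Real.log n| → θ ≠ 0 →
      ‖charIntegral T θ‖ ≤ 2 * U / |(m : ℝ) - n| := by
    intro θ h3 h4
    refine (norm_charIntegral_le_div T h4).trans ?_
    rw [h3]
    calc 2 / |Real.log m - Real.log n| ≤ 2 / (|(m : ℝ) - n| / U) := by gcongr
      _ = _ := by field_simp
  have h5 := mul_le_mul (h2 _ rfl hne) (h2 _ (abs_sub_comm _ _) hne') (norm_nonneg _)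
    (by positivity)
  rw [hab, mul_min_of_nonneg _ _ (by positivity)]
  refine le_min (by linarith) (h5.trans (le_of_eq ?_))
  field_simp
  ring

/-- Summation of the pair weights over all pairs of products `k * v₁ ⋯ vₙ`. -/
theorem sum_pairWeight_le {B : Finset ℕ} {y : ℕ} (hB : ∀ p ∈ B, p.Prime ∧ p ≤ y)
    (hB5 : ∀ p ∈ B, 5 ≤ p) {K : ℝ} (hK : 1 < K) (hy : 32 * Real.log y ≤ Real.log K)
    {A J : Finset ℕ} {r : ℕ} (hJ : ∀ p ∈ J, p.Prime ∧ p ∉ B)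
    (hA : ∀ k ∈ A, K ≤ (k : ℝ) ∧ (k : ℝ) < 2 * K ∧ (∀ p ∈ B, ¬ p ∣ k) ∧
      ∑ p ∈ J, k.factorization p ≤ r) (n : ℕ) {H : ℝ} (hH : 0 < H) :
    ∑ x ∈ A ×ˢ Fintype.piFinset (fun _ : Fin n => J),
      ∑ x' ∈ A ×ˢ Fintype.piFinset (fun _ : Fin n => J),
        pairWeight H (x'.1 * ∏ i, x'.2 i) (x.1 * ∏ i, x.2 i) ≤
      (n + r).factorial * ((J.card : ℝ) ^ n * (A.card +
        48 * Real.exp 6 * K * H / (∏ p ∈ B, ((p : ℝ) / (p - 1))) ^ 2)) := by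
  set s := A ×ˢ Fintype.piFinset (fun _ : Fin n => J) with hs
  set V := ∏ p ∈ B, ((p : ℝ) / (p - 1)) with hV
  have hV0 : 0 < V := prod_pos fun p hp => by
    linarith [one_le_div_sub_one (hB5 p hp)]
  set F : ℝ := ((n + r).factorial : ℝ) with hF
  have hF0 : 0 ≤ F := Nat.cast_nonneg _
  set f : ℕ × (Fin n → ℕ) → ℕ := fun x => x.1 * ∏ i, x.2 i with hf
  set E := s.image f with hE
  have hvB : ∀ v ∈ Fintype.piFinset (fun _ : Fin n => J), ∀ p ∈ B, ¬ p ∣ ∏ i, v i := by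
    intro v hv p hp hdvd
    obtain ⟨i, -, hi⟩ := (hB p hp).1.prime.exists_mem_finset_dvd hdvd
    have h1 := hJ _ (Fintype.mem_piFinset.1 hv i)
    rw [(Nat.prime_dvd_prime_iff_eq (hB p hp).1 h1.1).1 hi] at hp
    exact h1.2 hp
  have hEB : ∀ m ∈ E, ∀ p ∈ B, ¬ p ∣ m := by
    intro m hm p hp hdvd
    obtain ⟨x, hx, rfl⟩ := mem_image.1 hm
    obtain ⟨h1, h2⟩ := mem_product.1 hx
    rcases (hB p hp).1.dvd_mul.1 hdvd with h | h
    · exact (hA _ h1).2.2.1 p hp h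
    · exact hvB _ h2 p hp h
  have hmult : ∀ N : ℕ, ∑ x' ∈ s, pairWeight H (f x') N ≤ F * ∑ m ∈ E, pairWeight H m N := by
    intro N
    rw [sum_comp (fun m => pairWeight H m N) f, mul_sum]
    refine sum_le_sum fun m _ => ?_
    rw [nsmul_eq_mul]
    refine mul_le_mul_of_nonneg_right ?_ (pairWeight_nonneg _ _ _)
    rw [hF, Nat.cast_le]
    exact card_factorizations_le (fun p hp => (hJ p hp).1) (fun k hk =>
      ⟨by rintro rfl; have := (hA 0 hk).1; push_cast at this; linarith, (hA k hk).2.2.2⟩) n m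
  have hsplit : ∀ N : ℕ, ∑ m ∈ E, pairWeight H m N ≤
      1 + ∑ m ∈ E.filter (fun m => m ≠ N), min 1 ((H / (((m : ℤ) - N).natAbs : ℝ)) ^ 2) := by
    intro N
    rw [← sum_filter_add_sum_filter_not E (fun m => m = N)]
    refine add_le_add ?_ (le_of_eq (sum_congr rfl fun m hm => if_neg (mem_filter.1 hm).2))
    calc ∑ m ∈ E.filter (fun m => m = N), pairWeight H m N
        ≤ ∑ m ∈ {N}, pairWeight H m N :=
          sum_le_sum_of_subset_of_nonneg (fun m hm => mem_singleton.2 (mem_filter.1 hm).2)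
            fun _ _ _ => pairWeight_nonneg _ _ _
      _ = 1 := by simp [pairWeight]
  have hoff : ∀ v ∈ Fintype.piFinset (fun _ : Fin n => J), ∑ k ∈ A,
      ∑ m ∈ E, pairWeight H m (f (k, v)) ≤
      A.card + 48 * Real.exp 6 * K * H / V ^ 2 := by
    intro v hv
    have h1 := sum_off_diagonal_le hB hB5 hK hy (hvB v hv) (A := A) (E := E)
      (fun k hk => ⟨(hA k hk).1, (hA k hk).2.1, (hA k hk).2.2.1⟩) hEB hH
    rw [← le_div_iff₀ (by positivity)] at h1
    calc ∑ k ∈ A, ∑ m ∈ E, pairWeight H m (f (k, v)) ≤ _ := sum_le_sum fun k _ => hsplit _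
      _ = A.card + _ := by rw [sum_add_distrib, sum_const, nsmul_eq_mul, mul_one]
      _ ≤ _ := by gcongr
  calc ∑ x ∈ s, ∑ x' ∈ s, pairWeight H (f x') (f x)
      ≤ ∑ x ∈ s, F * ∑ m ∈ E, pairWeight H m (f x) := sum_le_sum fun x _ => hmult _
    _ = F * ∑ v ∈ Fintype.piFinset (fun _ : Fin n => J), ∑ k ∈ A,
          ∑ m ∈ E, pairWeight H m (f (k, v)) := by rw [← mul_sum, hs, sum_product_right]
    _ ≤ F * ∑ v ∈ Fintype.piFinset (fun _ : Fin n => J),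
          (A.card + 48 * Real.exp 6 * K * H / V ^ 2) :=
        mul_le_mul_of_nonneg_left (sum_le_sum hoff) hF0
    _ = _ := by
        rw [sum_const, nsmul_eq_mul, Fintype.card_piFinset]
        simp

theorem natCast_cpow_eq {n : ℕ} (hn : 0 < n) (t : ℝ) :
    (n : ℂ) ^ (-(1 + (t : ℂ) * Complex.I)) =
      (1 / n : ℂ) * Complex.exp ((t * (-Real.log n) : ℝ) * Complex.I) := by
  have hn' : (n : ℂ) ≠ 0 := by exact_mod_cast hn.ne'
  rw [neg_add, Complex.cpow_add _ _ hn', Complex.cpow_neg_one, one_div,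
    Complex.cpow_def_of_ne_zero hn', ← Complex.natCast_log]
  congr 2
  push_cast
  ring

theorem mul_pow_eq_sum (A J : Finset ℕ) (hA : ∀ k ∈ A, 0 < k) (hJ : ∀ p ∈ J, 0 < p)
    (b : ℕ → ℂ) (n : ℕ) (t : ℝ) :
    (∑ k ∈ A, (k : ℂ) ^ (-(1 + (t : ℂ) * Complex.I))) *
        (∑ p ∈ J, b p * (p : ℂ) ^ (-(1 + (t : ℂ) * Complex.I))) ^ n =
      ∑ x ∈ A ×ˢ Fintype.piFinset (fun _ : Fin n => J),
        ((∏ i, b (x.2 i)) * (1 / (x.1 * ∏ i, x.2 i : ℕ))) *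
          Complex.exp ((t * (-Real.log (x.1 * ∏ i, x.2 i : ℕ)) : ℝ) * Complex.I) := by
  have hpow : (∑ p ∈ J, b p * (p : ℂ) ^ (-(1 + (t : ℂ) * Complex.I))) ^ n =
      ∑ v ∈ Fintype.piFinset (fun _ : Fin n => J),
        ∏ i, b (v i) * (v i : ℂ) ^ (-(1 + (t : ℂ) * Complex.I)) := by
    have := prod_univ_sum (fun _ : Fin n => J)
      fun _ p => b p * (p : ℂ) ^ (-(1 + (t : ℂ) * Complex.I))
    rw [← this]
    simp
  rw [hpow, sum_mul_sum, sum_product]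
  refine sum_congr rfl fun k hk => sum_congr rfl fun v hv => ?_
  have hv' := Fintype.mem_piFinset.1 hv
  have hprod : ∀ m : ℕ, ∀ w : Fin m → ℕ, ∏ i, (w i : ℂ) ^ (-(1 + (t : ℂ) * Complex.I)) =
      ((∏ i, w i : ℕ) : ℂ) ^ (-(1 + (t : ℂ) * Complex.I)) := by
    intro m
    induction m with
    | zero => simp
    | succ m ih =>
      intro w
      rw [Fin.prod_univ_succ, ih, Fin.prod_univ_succ]
      push_cast
      have := Complex.natCast_mul_natCast_cpow (w 0) (∏ i : Fin m, w i.succ)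
        (-(1 + (t : ℂ) * Complex.I))
      push_cast at this
      rw [this]
  have hpos : 0 < k * ∏ i, v i := Nat.mul_pos (hA k hk) (prod_pos fun i _ => hJ _ (hv' i))
  rw [prod_mul_distrib, hprod, mul_left_comm, ← Complex.natCast_mul_natCast_cpow, ← Nat.cast_mul,
    natCast_cpow_eq hpos, mul_assoc]

/-- The mean square of `K(1 + it) P(1 + it) ^ n`. -/
theorem integral_norm_sq_mul_pow_le {B : Finset ℕ} {y : ℕ} (hB : ∀ p ∈ B, p.Prime ∧ p ≤ y)
    (hB5 : ∀ p ∈ B, 5 ≤ p) {K P : ℝ} (hK : 1 < K) (hP : 1 ≤ P)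
    (hy : 32 * Real.log y ≤ Real.log K) {A J : Finset ℕ} {r : ℕ}
    (hJ : ∀ p ∈ J, p.Prime ∧ p ∉ B ∧ P ≤ (p : ℝ) ∧ (p : ℝ) < 2 * P)
    (hA : ∀ k ∈ A, K ≤ (k : ℝ) ∧ (k : ℝ) < 2 * K ∧ (∀ p ∈ B, ¬ p ∣ k) ∧
      ∑ p ∈ J, k.factorization p ≤ r) (b : ℕ → ℂ) (hb : ∀ p, ‖b p‖ ≤ 1) (n : ℕ)
    {T : ℝ} (hT : 0 < T) :
    ∫ t in (0 : ℝ)..T, ‖(∑ k ∈ A, (k : ℂ) ^ (-(1 + (t : ℂ) * Complex.I))) *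
        (∑ p ∈ J, b p * (p : ℂ) ^ (-(1 + (t : ℂ) * Complex.I))) ^ n‖ ^ 2 ≤
      384 * Real.exp 6 * ((n + r).factorial * 4 ^ n) *
        (T / (K * P ^ n * ∏ p ∈ B, ((p : ℝ) / (p - 1))) +
          1 / (∏ p ∈ B, ((p : ℝ) / (p - 1))) ^ 2) := by
  set V := ∏ p ∈ B, ((p : ℝ) / (p - 1)) with hV
  have hV0 : 0 < V := prod_pos fun p hp => by
    linarith [one_le_div_sub_one (hB5 p hp)]
  set s := A ×ˢ Fintype.piFinset (fun _ : Fin n => J) with hs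
  set f : ℕ × (Fin n → ℕ) → ℕ := fun x => x.1 * ∏ i, x.2 i with hf
  set Y := K * P ^ n with hY
  have hP0 : 0 < P := by linarith
  have hY0 : 0 < Y := by positivity
  set U := 2 * 2 ^ n * Y with hU
  have hU0 : 0 < U := by positivity
  have hA0 : ∀ k ∈ A, 0 < k := fun k hk => by
    have := (hA k hk).1
    exact_mod_cast (by linarith : (0 : ℝ) < k)
  have hJ0 : ∀ p ∈ J, 0 < p := fun p hp => (hJ p hp).1.pos
  have hsize : ∀ x ∈ s, 0 < f x ∧ Y ≤ (f x : ℝ) ∧ (f x : ℝ) ≤ U := by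
    intro x hx
    obtain ⟨h1, h2⟩ := mem_product.1 hx
    have h3 := Fintype.mem_piFinset.1 h2
    obtain ⟨h4, h5, -⟩ := hA _ h1
    have h6 : P ^ n ≤ ∏ i, (x.2 i : ℝ) := by
      have := prod_le_prod (s := univ) (f := fun _ : Fin n => P) (g := fun i => (x.2 i : ℝ))
        (fun _ _ => hP0.le) fun i _ => (hJ _ (h3 i)).2.2.1
      simpa using this
    have h7 : ∏ i, (x.2 i : ℝ) ≤ (2 * P) ^ n := by
      have := prod_le_prod (s := univ) (f := fun i => (x.2 i : ℝ)) (g := fun _ : Fin n => 2 * P)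
        (fun _ _ => Nat.cast_nonneg _) fun i _ => (hJ _ (h3 i)).2.2.2.le
      simpa using this
    refine ⟨Nat.mul_pos (hA0 _ h1) (prod_pos fun i _ => hJ0 _ (h3 i)), ?_, ?_⟩
    · simp only [hf]
      push_cast
      exact mul_le_mul h4 h6 (by positivity) (by linarith)
    · simp only [hf]
      push_cast
      calc (x.1 : ℝ) * ∏ i, (x.2 i : ℝ) ≤ (2 * K) * (2 * P) ^ n :=
            mul_le_mul h5.le h7 (prod_nonneg fun _ _ => Nat.cast_nonneg _) (by linarith)
        _ = U := by
            rw [hU, hY, mul_pow]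
            ring
  have hcoef : ∀ x ∈ s, ‖(∏ i, b (x.2 i)) * (1 / (f x : ℂ))‖ ≤ 1 / Y := by
    intro x hx
    obtain ⟨h1, h2, -⟩ := hsize x hx
    rw [norm_mul, norm_prod, norm_div, norm_one, Complex.norm_natCast]
    calc (∏ i, ‖b (x.2 i)‖) * (1 / (f x : ℝ)) ≤ 1 * (1 / Y) := by
          refine mul_le_mul (prod_le_one (fun _ _ => norm_nonneg _) fun _ _ => hb _) ?_
            (by positivity) zero_le_one
          gcongr
      _ = _ := one_mul _
  have hmv := mul_integral_norm_sq_le s (fun x => (∏ i, b (x.2 i)) * (1 / (f x : ℂ)))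
    (fun x => -Real.log (f x)) hT.le
  have hbound : ∑ x ∈ s, ∑ x' ∈ s, ‖(∏ i, b (x.2 i)) * (1 / (f x : ℂ))‖ *
      ‖(∏ i, b (x'.2 i)) * (1 / (f x' : ℂ))‖ *
      (‖charIntegral T (-Real.log (f x) - -Real.log (f x'))‖ *
        ‖charIntegral T (-Real.log (f x') - -Real.log (f x))‖) ≤
      4 * T ^ 2 / Y ^ 2 * ∑ x ∈ s, ∑ x' ∈ s, pairWeight (U / T) (f x') (f x) := by
    rw [mul_sum]
    refine sum_le_sum fun x hx => ?_
    rw [mul_sum]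
    refine sum_le_sum fun x' hx' => ?_
    obtain ⟨h1, -, h2⟩ := hsize x hx
    obtain ⟨h3, -, h4⟩ := hsize x' hx'
    have h5 := charIntegral_mul_le_pairWeight h3 h1 hT h4 h2
    rw [neg_sub_neg, neg_sub_neg]
    calc _ ≤ (1 / Y * (1 / Y)) * (4 * T ^ 2 * pairWeight (U / T) (f x') (f x)) := by
          refine mul_le_mul (mul_le_mul (hcoef x hx) (hcoef x' hx') (norm_nonneg _) (by positivity))
            h5 (by positivity) (by positivity)
      _ = _ := by ring
  have hpair := sum_pairWeight_le hB hB5 hK hy (A := A) (J := J) (r := r)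
    (fun p hp => ⟨(hJ p hp).1, (hJ p hp).2.1⟩) hA n (div_pos hU0 hT)
  have hAcard : (A.card : ℝ) ≤ 6 * K / V := by
    rw [le_div_iff₀ hV0]
    refine card_mul_prod_le hB hK ?_ A fun k hk => ⟨(hA k hk).1, (hA k hk).2.1, (hA k hk).2.2.1⟩
    have := Real.log_natCast_nonneg y
    linarith
  have hJcard : (J.card : ℝ) ≤ 2 * P := by
    have h1 : J ⊆ Ico ⌈P⌉₊ ⌈2 * P⌉₊ := fun p hp =>
      mem_Ico.2 ⟨Nat.ceil_le.2 (hJ p hp).2.2.1, Nat.lt_ceil.2 (hJ p hp).2.2.2⟩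
    have h2 : (J.card : ℝ) ≤ ((⌈2 * P⌉₊ - ⌈P⌉₊ : ℕ) : ℝ) := by
      have := card_le_card h1
      rw [Nat.card_Ico] at this
      exact_mod_cast this
    rw [Nat.cast_sub (Nat.ceil_mono (by linarith))] at h2
    have h3 := Nat.ceil_lt_add_one (a := 2 * P) (by linarith)
    have h4 := Nat.le_ceil P
    linarith
  have hJpow : (J.card : ℝ) ^ n ≤ 2 ^ n * P ^ n := by
    rw [← mul_pow]
    exact pow_le_pow_left₀ (Nat.cast_nonneg _) hJcard n
  simp only [mul_pow_eq_sum A J hA0 hJ0]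
  refine le_of_mul_le_mul_left ((hmv.trans hbound).trans ?_) hT
  set F : ℝ := ((n + r).factorial : ℝ) with hF
  have hF0 : 0 ≤ F := Nat.cast_nonneg _
  have h24 : (2 : ℝ) ^ n ≤ 4 ^ n := pow_le_pow_left₀ (by norm_num) (by norm_num) n
  have h44 : (2 : ℝ) ^ n * 2 ^ n = 4 ^ n := by
    rw [← mul_pow]
    norm_num
  have he : 1 ≤ Real.exp 6 := Real.one_le_exp (by norm_num)
  calc 4 * T ^ 2 / Y ^ 2 * ∑ x ∈ s, ∑ x' ∈ s, pairWeight (U / T) (f x') (f x)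
      ≤ 4 * T ^ 2 / Y ^ 2 * (F * ((2 ^ n * P ^ n) * (6 * K / V +
          48 * Real.exp 6 * K * (U / T) / V ^ 2))) := by
        refine mul_le_mul_of_nonneg_left (hpair.trans ?_) (by positivity)
        have : 0 ≤ 48 * Real.exp 6 * K * (U / T) / V ^ 2 := by positivity
        gcongr
    _ = T * (24 * (F * 2 ^ n) * (T / (Y * V)) +
          384 * Real.exp 6 * (F * (2 ^ n * 2 ^ n)) * (1 / V ^ 2)) := by
        rw [hU, hY]
        field_simp
        ring
    _ ≤ T * (384 * Real.exp 6 * (F * 4 ^ n) * (T / (Y * V)) +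
          384 * Real.exp 6 * (F * 4 ^ n) * (1 / V ^ 2)) := by
        rw [h44]
        have : 24 ≤ 384 * Real.exp 6 := by linarith
        gcongr
    _ = _ := by ring

theorem exists_factorial_mul_pow_le (r : ℕ) {δ : ℝ} (hδ : 0 < δ) :
    ∃ C : ℝ, 0 < C ∧ ∀ n : ℕ,
      ((n + r).factorial * 4 ^ n : ℝ) ≤ C * (n.factorial : ℝ) ^ (1 + δ) := by
  set a : ℝ := (8 : ℝ) ^ (1 / δ) with ha
  have ha0 : 0 < a := Real.rpow_pos_of_pos (by norm_num) _
  refine ⟨r.factorial * 2 ^ r * Real.exp a ^ δ, by positivity, fun n => ?_⟩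
  have hn0 : (0 : ℝ) < n.factorial := by exact_mod_cast n.factorial_pos
  have h1 : ((n + r).factorial : ℝ) ≤ 2 ^ (n + r) * n.factorial * r.factorial := by
    have h2 := Nat.add_choose_mul_factorial_mul_factorial n r
    have h3 := Nat.choose_le_two_pow (n + r) r
    rw [← h2]
    push_cast
    gcongr
    exact_mod_cast h3
  have h8 : (8 : ℝ) ^ n ≤ Real.exp a ^ δ * (n.factorial : ℝ) ^ δ := by
    have h2 := Real.pow_div_factorial_le_exp a ha0.le n
    rw [div_le_iff₀ hn0] at h2
    have h3 := Real.rpow_le_rpow (by positivity) h2 hδ.le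
    rw [Real.mul_rpow (by positivity) hn0.le] at h3
    refine le_trans (le_of_eq ?_) h3
    rw [← Real.rpow_natCast a, ← Real.rpow_mul ha0.le, ha, ← Real.rpow_mul (by norm_num),
      ← Real.rpow_natCast]
    congr 1
    field_simp
  rw [Real.rpow_add hn0, Real.rpow_one]
  calc ((n + r).factorial * 4 ^ n : ℝ) ≤
      2 ^ (n + r) * n.factorial * r.factorial * 4 ^ n := by gcongr
    _ = r.factorial * 2 ^ r * 8 ^ n * n.factorial := by
        rw [show (8 : ℝ) = 2 * 4 by norm_num, mul_pow, pow_add]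
        ring
    _ ≤ r.factorial * 2 ^ r * (Real.exp a ^ δ * (n.factorial : ℝ) ^ δ) * n.factorial := by gcongr
    _ = _ := by ring

theorem tsum_dyadic_eq_sum (L : ℝ) (p : ℕ → Prop) (f : ℕ → ℂ) :
    (∑' n : ℕ, if p n ∧ L ≤ (n : ℝ) ∧ (n : ℝ) < 2 * L then f n else 0) =
      ∑ n ∈ (Ico ⌈L⌉₊ ⌈2 * L⌉₊).filter p, f n := by
  have hmem : ∀ n, n ∈ (Ico ⌈L⌉₊ ⌈2 * L⌉₊).filter p ↔
      p n ∧ L ≤ (n : ℝ) ∧ (n : ℝ) < 2 * L := by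
    intro n
    rw [mem_filter, mem_Ico, Nat.ceil_le, Nat.lt_ceil, and_comm]
  rw [tsum_eq_sum (s := (Ico ⌈L⌉₊ ⌈2 * L⌉₊).filter p) fun n hn => if_neg (by rwa [← hmem])]
  exact sum_congr rfl fun n hn => if_pos ((hmem n).1 hn)

theorem indicatorPoly_eq_sum (K : ℝ) (S : Set ℕ) (t : ℝ) :
    indicatorPoly K S t = ∑ n ∈ (Ico ⌈K⌉₊ ⌈2 * K⌉₊).filter (· ∈ S),
      (n : ℂ) ^ (-(1 + (t : ℂ) * Complex.I)) :=
  tsum_dyadic_eq_sum K (· ∈ S) _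

theorem primeCoeffPoly_eq_sum (P : ℝ) (b : ℕ → ℂ) (t : ℝ) :
    primeCoeffPoly P b t = ∑ p ∈ (Ico ⌈P⌉₊ ⌈2 * P⌉₊).filter Nat.Prime,
      b p * (p : ℂ) ^ (-(1 + (t : ℂ) * Complex.I)) := by
  have := tsum_dyadic_eq_sum P Nat.Prime fun p => b p * (p : ℂ) ^ (-(1 + (t : ℂ) * Complex.I))
  unfold primeCoeffPoly
  convert this

theorem genPoly_eq_sum (M : ℝ) (c : ℕ → ℂ) (t : ℝ) :
    genPoly M c t = ∑ m ∈ Ico ⌈M⌉₊ ⌈2 * M⌉₊, c m * (m : ℂ) ^ (-(1 + (t : ℂ) * Complex.I)) := by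
  have := tsum_dyadic_eq_sum M (fun _ => True) fun m => c m * (m : ℂ) ^ (-(1 + (t : ℂ) * Complex.I))
  simpa [genPoly] using this

theorem continuous_sum_cpow (A : Finset ℕ) (hA : ∀ n ∈ A, 0 < n) (a : ℕ → ℂ) :
    Continuous fun t : ℝ => ∑ n ∈ A, a n * (n : ℂ) ^ (-(1 + (t : ℂ) * Complex.I)) := by
  refine continuous_finsetSum _ fun n hn => continuous_const.mul ?_
  simp only [natCast_cpow_eq (hA n hn)]
  fun_prop

theorem pos_of_mem_Ico_ceil {L x : ℝ} (hL : 0 < L) {n : ℕ} (hn : n ∈ Ico ⌈L⌉₊ ⌈x⌉₊) : 0 < n :=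
  (Nat.ceil_pos.2 hL).trans_le (mem_Ico.1 hn).1

theorem continuous_indicatorPoly {K : ℝ} (hK : 0 < K) (S : Set ℕ) :
    Continuous (indicatorPoly K S) := by
  have := continuous_sum_cpow ((Ico ⌈K⌉₊ ⌈2 * K⌉₊).filter (· ∈ S))
    (fun n hn => pos_of_mem_Ico_ceil hK (mem_filter.1 hn).1) fun _ => 1
  simp only [one_mul] at this
  exact this.congr fun t => (indicatorPoly_eq_sum K S t).symm

theorem continuous_primeCoeffPoly (P : ℝ) (b : ℕ → ℂ) : Continuous (primeCoeffPoly P b) :=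
  (continuous_sum_cpow ((Ico ⌈P⌉₊ ⌈2 * P⌉₊).filter Nat.Prime)
    (fun _ hn => (mem_filter.1 hn).2.pos) b).congr fun t => (primeCoeffPoly_eq_sum P b t).symm

theorem continuous_genPoly {M : ℝ} (hM : 0 < M) (c : ℕ → ℂ) : Continuous (genPoly M c) :=
  (continuous_sum_cpow (Ico ⌈M⌉₊ ⌈2 * M⌉₊) (fun _ hn => pos_of_mem_Ico_ceil hM hn) c).congr
    fun t => (genPoly_eq_sum M c t).symm

/-- A power of a large prime polynomial detects the set where it is large. -/
theorem setIntegral_large_small_le {K M P T₀ T α₁ α₂ : ℝ} (hK : 0 < K) (hM : 0 < M) (hP : 1 ≤ P)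
    (hT₀ : 0 < T₀) (hT : T₀ ≤ T) (S : Set ℕ) (c b : ℕ → ℂ) (n : ℕ) :
    (∫ t in {t : ℝ | t ∈ Set.Icc T₀ T ∧ P ^ (-α₁) ≤ ‖primeCoeffPoly P b t‖ ∧
        ‖genPoly M c t‖ ≤ M ^ (-α₂)}, ‖indicatorPoly K S t * genPoly M c t‖ ^ 2) ≤
      M ^ (-(2 * α₂)) * P ^ (2 * α₁ * n) *
        ∫ t in (0 : ℝ)..T, ‖indicatorPoly K S t * primeCoeffPoly P b t ^ n‖ ^ 2 := by
  have hcK := continuous_indicatorPoly hK S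
  have hcM := continuous_genPoly hM c
  have hcP := continuous_primeCoeffPoly P b
  have hP0 : 0 < P := by linarith
  set W := {t : ℝ | t ∈ Set.Icc T₀ T ∧ P ^ (-α₁) ≤ ‖primeCoeffPoly P b t‖ ∧
        ‖genPoly M c t‖ ≤ M ^ (-α₂)} with hW
  have hWc : IsClosed W := isClosed_Icc.inter ((isClosed_le continuous_const hcP.norm).inter
    (isClosed_le hcM.norm continuous_const))
  have hWsub : W ⊆ Set.Ioc 0 T := fun t ht => ⟨hT₀.trans_le ht.1.1, ht.1.2⟩
  have hint : ∀ f : ℝ → ℝ, Continuous f → MeasureTheory.IntegrableOn f (Set.Ioc 0 T) :=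
    fun f hf => (hf.integrableOn_Icc (a := 0) (b := T)).mono_set Set.Ioc_subset_Icc_self
  set Q := M ^ (-(2 * α₂)) * P ^ (2 * α₁ * n) with hQ
  have hQ0 : 0 ≤ Q := by positivity
  have hpt : ∀ t ∈ W, ‖indicatorPoly K S t * genPoly M c t‖ ^ 2 ≤
      Q * ‖indicatorPoly K S t * primeCoeffPoly P b t ^ n‖ ^ 2 := by
    rintro t ⟨-, h1, h2⟩
    have h3 : ‖genPoly M c t‖ ^ 2 ≤ M ^ (-(2 * α₂)) := by
      calc ‖genPoly M c t‖ ^ 2 ≤ (M ^ (-α₂)) ^ 2 := pow_le_pow_left₀ (norm_nonneg _) h2 2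
        _ = _ := by
          rw [← Real.rpow_natCast, ← Real.rpow_mul hM.le]
          congr 1
          push_cast
          ring
    have h4 : 1 ≤ P ^ (2 * α₁ * n) * (‖primeCoeffPoly P b t‖ ^ n) ^ 2 := by
      calc (1 : ℝ) = P ^ (2 * α₁ * n) * ((P ^ (-α₁)) ^ n) ^ 2 := by
            rw [← pow_mul, ← Real.rpow_natCast, ← Real.rpow_mul hP0.le, ← Real.rpow_add hP0]
            push_cast
            ring_nf
            simp
        _ ≤ _ := by gcongr
    rw [norm_mul, norm_mul, norm_pow, mul_pow, mul_pow]
    calc ‖indicatorPoly K S t‖ ^ 2 * ‖genPoly M c t‖ ^ 2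
        ≤ ‖indicatorPoly K S t‖ ^ 2 * (M ^ (-(2 * α₂)) *
          (P ^ (2 * α₁ * n) * (‖primeCoeffPoly P b t‖ ^ n) ^ 2)) := by
          refine mul_le_mul_of_nonneg_left (h3.trans ?_) (sq_nonneg _)
          exact le_mul_of_one_le_right (by positivity) h4
      _ = _ := by
          rw [hQ]
          ring
  calc (∫ t in W, ‖indicatorPoly K S t * genPoly M c t‖ ^ 2)
      ≤ ∫ t in W, Q * ‖indicatorPoly K S t * primeCoeffPoly P b t ^ n‖ ^ 2 :=
        MeasureTheory.setIntegral_mono_on ((hint _ (by fun_prop)).mono_set hWsub)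
          ((hint _ (by fun_prop)).mono_set hWsub) hWc.measurableSet hpt
    _ ≤ ∫ t in Set.Ioc 0 T, Q * ‖indicatorPoly K S t * primeCoeffPoly P b t ^ n‖ ^ 2 :=
        MeasureTheory.setIntegral_mono_set (hint _ (by fun_prop))
          (Filter.Eventually.of_forall fun t => by positivity)
          (Filter.Eventually.of_forall hWsub)
    _ = _ := by
        rw [intervalIntegral.integral_of_le (by linarith), MeasureTheory.integral_const_mul]

/-- The Euler product over the sifting primes up to `X ^ η` is at least a constant times
`log X`. -/
theorem mul_log_le_prod_siftingPrimes {m : ℕ} {Z : Fin m → ℝ} (hZ : ∀ i, 1 ≤ Z i) {η X : ℝ}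
    (hη : 0 < η) (hX : Real.exp (2 / η) ≤ X) :
    η / (6 * Real.exp 8 ^ m) * Real.log X ≤
      ∏ p ∈ siftingPrimes Z ⌊X ^ η⌋₊, ((p : ℝ) / (p - 1)) := by
  have hX0 : 0 < X := (Real.exp_pos _).trans_le hX
  have hlog : 2 / η ≤ Real.log X := (Real.le_log_iff_exp_le hX0).2 hX
  rw [div_le_iff₀ hη] at hlog
  have hX1 : 1 ≤ X ^ η := by
    rw [Real.rpow_def_of_pos hX0]
    exact Real.one_le_exp (by linarith)
  have hfl : 1 ≤ ⌊X ^ η⌋₊ := Nat.le_floor (by exact_mod_cast hX1)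
  have hfl' : (1 : ℝ) ≤ (⌊X ^ η⌋₊ : ℝ) := by exact_mod_cast hfl
  have h1 : X ^ η / 2 ≤ (⌊X ^ η⌋₊ : ℝ) := by
    have := Nat.lt_floor_add_one (X ^ η)
    linarith
  have h2 : η / 2 * Real.log X ≤ Real.log ⌊X ^ η⌋₊ := by
    have h3 := Real.log_le_log (by positivity) h1
    rw [Real.log_div (by positivity) (by norm_num), Real.log_rpow hX0] at h3
    have := Real.log_two_lt_d9
    linarith
  have h4 := h2.trans (log_le_prod_siftingPrimes hZ _)
  rw [div_mul_eq_mul_div, div_le_iff₀ (by positivity)]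
  linarith

theorem sum_factorization_le_of_filter {J : Finset ℕ} {q : ℕ → Prop} [DecidablePred q] (n : ℕ)
    (hJ : ∀ p ∈ J, q p) :
    ∑ p ∈ J, n.factorization p ≤ ∑ p ∈ n.primeFactors.filter q, n.factorization p := by
  rw [← sum_filter_of_ne (p := fun p => p ∈ n.primeFactors) fun p _ h => by
    rw [← Nat.support_factorization]
    exact Finsupp.mem_support_iff.2 h]
  refine sum_le_sum_of_subset fun p hp => ?_
  obtain ⟨h1, h2⟩ := mem_filter.1 hp
  exact mem_filter.2 ⟨h2, hJ p h1⟩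

/-- The mean square of `K(1 + it) P(1 + it) ^ n` over `[0, T]`, for `K` supported on a sifted
set. -/
theorem integral_indicatorPoly_mul_pow_le {ε : ℝ} (hε : 0 < ε) (r : ℕ) :
    ∃ C : ℝ, 0 < C ∧ ∃ X₀ : ℝ, 1 < X₀ ∧ ∀ X : ℝ, X₀ ≤ X → ∀ T : ℝ, 0 < T →
    ∀ P : ℝ, 1 ≤ P → ∀ K : ℝ, X ^ ε ≤ K →
    ∀ Z : Fin r → ℝ, (∀ i, 1 ≤ Z i) → ∀ S : Set ℕ,
      (∀ n ∈ S, (∑ p ∈ n.primeFactors.filter fun p : ℕ => P ≤ (p : ℝ) ∧ (p : ℝ) ≤ 2 * P,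
        n.factorization p) ≤ r) →
      (∀ n ∈ S, ∀ p : ℕ, p.Prime → p ∣ n → (p : ℝ) ≤ X ^ (0.01 : ℝ) →
        ∃ i : Fin r, Z i ≤ (p : ℝ) ∧ (p : ℝ) ≤ Z i ^ 2) →
    ∀ b : ℕ → ℂ, (∀ p : ℕ, ‖b p‖ ≤ 1) → ∀ n : ℕ, X ≤ K * P ^ n →
      ∫ t in (0 : ℝ)..T, ‖indicatorPoly K S t * primeCoeffPoly P b t ^ n‖ ^ 2 ≤
        C * ((n + r).factorial * 4 ^ n) *
          (T / (X * Real.log X) + 1 / Real.log X ^ 2) := by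
  set η : ℝ := min 0.01 (ε / 32) with hη
  have hη0 : 0 < η := lt_min (by norm_num) (by positivity)
  set c : ℝ := η / (6 * Real.exp 8 ^ (r + 1)) with hc
  have hc0 : 0 < c := by positivity
  refine ⟨384 * Real.exp 6 * (1 / c + 1 / c ^ 2), by positivity, Real.exp (2 / η),
    Real.one_lt_exp_iff.2 (by positivity), ?_⟩
  intro X hX T hT P hP K hK Z hZ S hS1 hS2 b hb n hXn
  have hX1 : 1 < X := (Real.one_lt_exp_iff.2 (by positivity)).trans_le hX
  have hX0 : 0 < X := by linarith
  have hlogX : 0 < Real.log X := Real.log_pos hX1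
  have hK1 : 1 < K := (Real.one_lt_rpow hX1 hε).trans_le hK
  set y := ⌊X ^ η⌋₊ with hy
  have hyX : (y : ℝ) ≤ X ^ η := Nat.floor_le (by positivity)
  have hylog : 32 * Real.log y ≤ Real.log K := by
    have h1 : Real.log y ≤ η * Real.log X := by
      rw [← Real.log_rpow hX0]
      refine Real.log_le_log ?_ hyX
      exact_mod_cast Nat.floor_pos.2 (Real.one_le_rpow hX1.le hη0.le)
    have h2 : ε * Real.log X ≤ Real.log K := by
      rw [← Real.log_rpow hX0]
      exact Real.log_le_log (by positivity) hK
    have h3 : η * Real.log X ≤ ε / 32 * Real.log X :=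
      mul_le_mul_of_nonneg_right (min_le_right _ _) hlogX.le
    linarith
  set Z' : Fin (r + 1) → ℝ := Fin.cons P Z with hZ'
  have hZ'1 : ∀ i, 1 ≤ Z' i := fun i => Fin.cases hP hZ i
  set B := siftingPrimes Z' y with hB
  have hmemB : ∀ p ∈ B, p.Prime ∧ p ≤ y ∧ 5 ≤ p ∧ ∀ i, ¬ (Z' i ≤ p ∧ (p : ℝ) ≤ Z' i ^ 2) := by
    intro p hp
    obtain ⟨h1, h2, h3, h4⟩ := mem_filter.1 hp
    exact ⟨h2, (mem_Icc.1 h1).2, h3, h4⟩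
  set V := ∏ p ∈ B, ((p : ℝ) / (p - 1)) with hV
  have hVc : c * Real.log X ≤ V := mul_log_le_prod_siftingPrimes hZ'1 hη0 hX
  have hV0 : 0 < V := (mul_pos hc0 hlogX).trans_le hVc
  have hJmem : ∀ p ∈ (Ico ⌈P⌉₊ ⌈2 * P⌉₊).filter Nat.Prime,
      p.Prime ∧ P ≤ (p : ℝ) ∧ (p : ℝ) < 2 * P := by
    intro p hp
    obtain ⟨h1, h2⟩ := mem_filter.1 hp
    obtain ⟨h3, h4⟩ := mem_Ico.1 h1
    exact ⟨h2, Nat.ceil_le.1 h3, Nat.lt_ceil.1 h4⟩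
  have hcore := integral_norm_sq_mul_pow_le (B := B) (y := y)
    (fun p hp => ⟨(hmemB p hp).1, (hmemB p hp).2.1⟩) (fun p hp => (hmemB p hp).2.2.1) hK1 hP hylog
    (A := (Ico ⌈K⌉₊ ⌈2 * K⌉₊).filter (· ∈ S)) (J := (Ico ⌈P⌉₊ ⌈2 * P⌉₊).filter Nat.Prime) (r := r)
    (fun p hp => by
      obtain ⟨h1, h2, h3⟩ := hJmem p hp
      refine ⟨h1, fun hpB => ?_, h2, h3⟩
      obtain ⟨-, -, h5, h6⟩ := hmemB p hpB
      have h7 : (5 : ℝ) ≤ p := by exact_mod_cast h5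
      refine h6 0 ⟨h2, ?_⟩
      simp only [hZ', Fin.cons_zero]
      nlinarith)
    (fun k hk => by
      obtain ⟨h1, h2⟩ := mem_filter.1 hk
      obtain ⟨h3, h4⟩ := mem_Ico.1 h1
      refine ⟨Nat.ceil_le.1 h3, Nat.lt_ceil.1 h4, fun p hp hdvd => ?_, ?_⟩
      · obtain ⟨h5, h6, -, h7⟩ := hmemB p hp
        have h8 : (p : ℝ) ≤ X ^ (0.01 : ℝ) := by
          have h9 : (p : ℝ) ≤ y := by exact_mod_cast h6
          exact h9.trans (hyX.trans (Real.rpow_le_rpow_of_exponent_le hX1.le (min_le_left _ _)))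
        obtain ⟨i, hi⟩ := hS2 k h2 p h5 hdvd h8
        exact h7 i.succ hi
      · refine (sum_factorization_le_of_filter k fun p hp => ?_).trans (hS1 k h2)
        exact ⟨(hJmem p hp).2.1, (hJmem p hp).2.2.le⟩)
    b hb n hT
  simp only [← indicatorPoly_eq_sum, ← primeCoeffPoly_eq_sum] at hcore
  refine hcore.trans ?_
  have h1 : T / (K * P ^ n * V) ≤ 1 / c * (T / (X * Real.log X)) := by
    calc T / (K * P ^ n * V) ≤ T / (X * (c * Real.log X)) := by gcongr
      _ = _ := by field_simp
  have h2 : 1 / V ^ 2 ≤ 1 / c ^ 2 * (1 / Real.log X ^ 2) := by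
    calc 1 / V ^ 2 ≤ 1 / (c * Real.log X) ^ 2 := by gcongr
      _ = _ := by field_simp
  have h3 : 0 ≤ T / (X * Real.log X) := by positivity
  have h4 : 0 ≤ 1 / Real.log X ^ 2 := by positivity
  have h5 : 0 < 1 / c := by positivity
  have h6 : 0 < 1 / c ^ 2 := by positivity
  calc 384 * Real.exp 6 * ((n + r).factorial * 4 ^ n) * (T / (K * P ^ n * V) + 1 / V ^ 2)
      ≤ 384 * Real.exp 6 * ((n + r).factorial * 4 ^ n) *
        ((1 / c + 1 / c ^ 2) * (T / (X * Real.log X) + 1 / Real.log X ^ 2)) := by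
        refine mul_le_mul_of_nonneg_left ?_ (by positivity)
        nlinarith
    _ = _ := by ring

end

/-- Proposition 2: a mean square bound on the set where `|P(1+it)| ≥ P^{-α₁}` and
`|M(1+it)| ≤ M^{-α₂}`. -/
theorem prop_large_small_values_mean_square (ε : ℝ) (hε : 0 < ε) (r : ℕ) (hr : 1 ≤ r)
    (δ : ℝ) (hδ : 0 < δ) :
    ∃ C : ℝ, 0 < C ∧ ∃ X₀ : ℝ, ∀ X : ℝ, X₀ ≤ X →
    ∀ T : ℝ, X ^ (0.01 : ℝ) ≤ T →
    ∀ P : ℝ, 1 ≤ P → P ≤ X ^ (0.01 : ℝ) →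
    ∀ α₁ α₂ : ℝ, 0 ≤ α₁ → α₁ ≤ 1 → 0 ≤ α₂ → α₂ ≤ 1 →
    ∀ K M : ℝ, K = X / M → X ^ ε ≤ K →
    ∀ Z : Fin r → ℝ, (∀ i, 1 ≤ Z i) →
    ∀ S : Set ℕ,
      (∀ n ∈ S,
        (∑ p ∈ n.primeFactors.filter fun p : ℕ => P ≤ (p : ℝ) ∧ (p : ℝ) ≤ 2 * P,
          n.factorization p) ≤ r) →
      (∀ n ∈ S, ∀ p : ℕ, p.Prime → p ∣ n → (p : ℝ) ≤ X ^ (0.01 : ℝ) →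
        ∃ i : Fin r, Z i ≤ (p : ℝ) ∧ (p : ℝ) ≤ Z i ^ 2) →
    ∀ c : ℕ → ℂ, (∀ m : ℕ, M ≤ (m : ℝ) → (m : ℝ) < 2 * M → ‖c m‖ ≤ drFun r m) →
    ∀ b : ℕ → ℂ, (∀ p : ℕ, ‖b p‖ ≤ 1) →
      (∫ t in {t : ℝ | t ∈ Set.Icc (X ^ (0.01 : ℝ)) T ∧
            P ^ (-α₁) ≤ ‖primeCoeffPoly P b t‖ ∧ ‖genPoly M c t‖ ≤ M ^ (-α₂)},
          ‖indicatorPoly K S t * genPoly M c t‖ ^ 2)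
        ≤ C * M ^ (-(2 * α₂)) *
          P ^ ((2 + 10 * ε) * α₁ * (⌈Real.log (X / K) / Real.log P⌉₊ : ℝ)) *
          ((Nat.factorial ⌈Real.log (X / K) / Real.log P⌉₊ : ℝ)) ^ ((1 : ℝ) + δ) *
          (T / (X * Real.log X) + 1 / Real.log X ^ 2) := by
  obtain ⟨C₁, hC₁, hfac⟩ := exists_factorial_mul_pow_le r hδ
  obtain ⟨C₂, hC₂, X₀, hX₀, hmain⟩ := integral_indicatorPoly_mul_pow_le hε r
  refine ⟨C₂ * C₁, by positivity, X₀, ?_⟩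
  intro X hX T hT P hP _ α₁ α₂ hα₁ _ _ _ K M hKM hK Z hZ S hS1 hS2 c _ b hb
  have hX1 : 1 < X := hX₀.trans_le hX
  have hX0 : 0 < X := by linarith
  have hlogX : 0 < Real.log X := Real.log_pos hX1
  have hT₀ : 0 < X ^ (0.01 : ℝ) := by positivity
  have hT0 : 0 < T := hT₀.trans_le hT
  have hK0 : 0 < K := (Real.rpow_pos_of_pos hX0 ε).trans_le hK
  have hM0 : 0 < M := by
    rw [hKM] at hK0
    exact (div_pos_iff_of_pos_left hX0).1 hK0
  have hKMX : K * M = X := by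
    rw [hKM]
    field_simp
  have hXK : X / K = M := by
    rw [← hKMX]
    field_simp
  rw [hXK]
  set ℓ := ⌈Real.log M / Real.log P⌉₊ with hℓ
  have hP0 : 0 < P := by linarith
  rcases hP.eq_or_lt with hP1 | hP1
  · have hzero : ∀ t, primeCoeffPoly P b t = 0 := by
      intro t
      rw [primeCoeffPoly_eq_sum, ← hP1]
      refine Finset.sum_eq_zero fun p hp => ?_
      obtain ⟨h1, h2⟩ := Finset.mem_filter.1 hp
      have h3 := Nat.lt_ceil.1 (Finset.mem_Ico.1 h1).2
      have h4 : (2 : ℝ) ≤ p := by exact_mod_cast h2.two_le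
      linarith
    have hempty : {t : ℝ | t ∈ Set.Icc (X ^ (0.01 : ℝ)) T ∧
        P ^ (-α₁) ≤ ‖primeCoeffPoly P b t‖ ∧ ‖genPoly M c t‖ ≤ M ^ (-α₂)} = ∅ := by
      refine Set.eq_empty_of_forall_notMem fun t ht => ?_
      have h1 := ht.2.1
      rw [hzero, norm_zero] at h1
      exact absurd h1 (not_le.2 (Real.rpow_pos_of_pos hP0 _))
    rw [hempty, MeasureTheory.setIntegral_empty]
    positivity
  have hXn : X ≤ K * P ^ ℓ := by
    rw [← hKMX]
    refine mul_le_mul_of_nonneg_left ?_ hK0.le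
    have h1 : Real.log M ≤ ℓ * Real.log P :=
      (div_le_iff₀ (Real.log_pos hP1)).1 (Nat.le_ceil _)
    rw [← Real.log_pow] at h1
    exact (Real.log_le_log_iff hM0 (by positivity)).1 h1
  have h1 := setIntegral_large_small_le hK0 hM0 hP hT₀ hT (α₁ := α₁) (α₂ := α₂) S c b ℓ
  have h2 := hmain X hX T hT0 P hP K hK Z hZ S hS1 hS2 b hb ℓ hXn
  have h3 : P ^ (2 * α₁ * ℓ) ≤ P ^ ((2 + 10 * ε) * α₁ * ℓ) := by
    refine Real.rpow_le_rpow_of_exponent_le hP ?_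
    have : 0 ≤ ε * α₁ * ℓ := by positivity
    linarith
  have h4 : 0 ≤ T / (X * Real.log X) + 1 / Real.log X ^ 2 := by positivity
  calc _ ≤ _ := h1
    _ ≤ M ^ (-(2 * α₂)) * P ^ ((2 + 10 * ε) * α₁ * ℓ) *
        (C₂ * (C₁ * (ℓ.factorial : ℝ) ^ (1 + δ)) *
          (T / (X * Real.log X) + 1 / Real.log X ^ 2)) := by
        refine mul_le_mul (mul_le_mul_of_nonneg_left h3 (by positivity)) (h2.trans ?_)
          (intervalIntegral.integral_nonneg hT0.le fun t _ => sq_nonneg _) (by positivity)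
        exact mul_le_mul_of_nonneg_right (mul_le_mul_of_nonneg_left (hfac ℓ) hC₂.le) h4
    _ = _ := by ring
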